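/- arXiv:1106.4972 — 2 statements merged into one kernel-verified Lean document; each statement's English description precedes it below -/
import Mathlib

section
/- Let R be a Cohen–Macaulay Noetherian local ring with dualizing complex, N a G–Gorenstein R-module, and M a maximal Cohen–Macaulay R-module of finite injective dimension. Then Hom_R(M, N) is strongly torsion free, i.e., Tor_1^R(F, Hom_R(M, N)) = 0 for every R-module F of finite flat dimension. -/
universe u

namespace GG

open RingTheory.Sequence

variable (R : Type u) [CommRing R]

/-- A module `N` is Gorenstein injective if it is a kernel in a `Hom(Inj,−)`-exact exact
doubly infinite complex of injective modules. -/
def IsGorensteinInjective (N : Type u) [AddCommGroup N] [Module R N] : Prop :=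
  ∃ (X : ℤ → ModuleCat.{u} R) (d : ∀ n : ℤ, X n →ₗ[R] X (n + 1)),
    (∀ n, Module.Injective R (X n)) ∧
    (∀ n, LinearMap.range (d n) = LinearMap.ker (d (n + 1))) ∧
    (∀ (I : ModuleCat.{u} R), Module.Injective R I →
      ∀ (n : ℤ) (φ : I →ₗ[R] X (n + 1)), (d (n + 1)).comp φ = 0 →
        ∃ ψ : I →ₗ[R] X n, (d n).comp ψ = φ) ∧
    Nonempty (N ≃ₗ[R] LinearMap.ker (d 0))

/-- A module `N` is Gorenstein projective if it is a kernel in a `Hom(−,Proj)`-exact exact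
doubly infinite complex of projective modules. -/
def IsGorensteinProjective (N : Type u) [AddCommGroup N] [Module R N] : Prop :=
  ∃ (X : ℤ → ModuleCat.{u} R) (d : ∀ n : ℤ, X n →ₗ[R] X (n + 1)),
    (∀ n, Module.Projective R (X n)) ∧
    (∀ n, LinearMap.range (d n) = LinearMap.ker (d (n + 1))) ∧
    (∀ (P : ModuleCat.{u} R), Module.Projective R P →
      ∀ (n : ℤ) (φ : X (n + 1) →ₗ[R] P), φ.comp (d n) = 0 →
        ∃ ψ : X (n + 1 + 1) →ₗ[R] P, ψ.comp (d (n + 1)) = φ) ∧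
    Nonempty (N ≃ₗ[R] LinearMap.ker (d 0))

/-- A module `N` is Gorenstein flat if it is a kernel in an `(Inj ⊗ −)`-exact exact
doubly infinite complex of flat modules. -/
def IsGorensteinFlat (N : Type u) [AddCommGroup N] [Module R N] : Prop :=
  ∃ (X : ℤ → ModuleCat.{u} R) (d : ∀ n : ℤ, X n →ₗ[R] X (n + 1)),
    (∀ n, Module.Flat R (X n)) ∧
    (∀ n, LinearMap.range (d n) = LinearMap.ker (d (n + 1))) ∧
    (∀ (I : ModuleCat.{u} R), Module.Injective R I →
      ∀ n : ℤ, LinearMap.range (LinearMap.lTensor (R := R) I (d n)) =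
        LinearMap.ker (LinearMap.lTensor (R := R) I (d (n + 1)))) ∧
    Nonempty (N ≃ₗ[R] LinearMap.ker (d 0))

/-- Existence of a right resolution of length `≤ n` by modules satisfying `P`. -/
def CoresolutionLE (P : ModuleCat.{u} R → Prop) (M : Type u) [AddCommGroup M] [Module R M]
    (n : ℕ) : Prop :=
  ∃ (G : ℕ → ModuleCat.{u} R) (d : ∀ i : ℕ, G i →ₗ[R] G (i + 1)) (ε : M →ₗ[R] G 0),
    (∀ i, P (G i)) ∧ Function.Injective ε ∧
    LinearMap.range ε = LinearMap.ker (d 0) ∧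
    (∀ i, LinearMap.range (d i) = LinearMap.ker (d (i + 1))) ∧
    (∀ i, n < i → ∀ x : G i, x = 0)

/-- Existence of a left resolution of length `≤ n` by modules satisfying `P`. -/
def ResolutionLE (P : ModuleCat.{u} R → Prop) (M : Type u) [AddCommGroup M] [Module R M]
    (n : ℕ) : Prop :=
  ∃ (G : ℕ → ModuleCat.{u} R) (d : ∀ i : ℕ, G (i + 1) →ₗ[R] G i) (ε : G 0 →ₗ[R] M),
    (∀ i, P (G i)) ∧ Function.Surjective ε ∧
    LinearMap.ker ε = LinearMap.range (d 0) ∧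
    (∀ i, LinearMap.ker (d i) = LinearMap.range (d (i + 1))) ∧
    (∀ i, n < i → ∀ x : G i, x = 0)

/-- `Gid_R M ≤ n`. -/
def gidLE (M : Type u) [AddCommGroup M] [Module R M] (n : ℕ) : Prop :=
  CoresolutionLE R (fun N => IsGorensteinInjective R N) M n

/-- `id_R M ≤ n`. -/
def idLE (M : Type u) [AddCommGroup M] [Module R M] (n : ℕ) : Prop :=
  CoresolutionLE R (fun N => Module.Injective R N) M n

/-- `pd_R M ≤ n`. -/
def pdLE (M : Type u) [AddCommGroup M] [Module R M] (n : ℕ) : Prop :=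
  ResolutionLE R (fun N => Module.Projective R N) M n

/-- `fd_R M ≤ n`. -/
def fdLE (M : Type u) [AddCommGroup M] [Module R M] (n : ℕ) : Prop :=
  ResolutionLE R (fun N => Module.Flat R N) M n

/-- `Gfd_R M ≤ n`. -/
def gfdLE (M : Type u) [AddCommGroup M] [Module R M] (n : ℕ) : Prop :=
  ResolutionLE R (fun N => IsGorensteinFlat R N) M n

/-- Gorenstein injective dimension, as an extended natural number. -/
noncomputable def gid (M : Type u) [AddCommGroup M] [Module R M] : ℕ∞ :=
  sInf {c : ℕ∞ | ∃ n : ℕ, c = n ∧ gidLE R M n}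

/-- The depth of a module over a local ring: the supremum of the lengths of regular
sequences contained in the maximal ideal. -/
noncomputable def mdepth [IsLocalRing R] (M : Type u) [AddCommGroup M] [Module R M] : ℕ∞ :=
  sSup {c : ℕ∞ | ∃ rs : List R, c = rs.length ∧
    (∀ r ∈ rs, r ∈ IsLocalRing.maximalIdeal R) ∧ RingTheory.Sequence.IsRegular M rs}

/-- The Krull dimension of a module: the Krull dimension of its support. -/
noncomputable def mdim (M : Type u) [AddCommGroup M] [Module R M] : WithBot ℕ∞ :=
  Order.krullDim ↥(Module.support R M)

/-- The height of a prime in the support of `M`. -/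
noncomputable def htM (M : Type u) [AddCommGroup M] [Module R M] (p : PrimeSpectrum R) : ℕ∞ :=
  ⨆ h : p ∈ Module.support R M, Order.height (⟨p, h⟩ : ↥(Module.support R M))

/-- A Cohen–Macaulay module over a local ring: depth equals Krull dimension. -/
def IsCMModule [IsLocalRing R] (M : Type u) [AddCommGroup M] [Module R M] : Prop :=
  (mdepth R M : WithBot ℕ∞) = mdim R M

/-- A maximal Cohen–Macaulay module over a local ring. -/
def IsMaximalCM [IsLocalRing R] (M : Type u) [AddCommGroup M] [Module R M] : Prop :=
  IsCMModule R M ∧ mdim R M = ringKrullDim R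

/-- A Cohen–Macaulay local ring. -/
def IsCMLocalRing [IsLocalRing R] : Prop :=
  (mdepth R R : WithBot ℕ∞) = ringKrullDim R

/-- A Gorenstein local ring: a Noetherian local ring of finite self-injective dimension. -/
def IsGorensteinLocalRing [IsLocalRing R] : Prop :=
  IsNoetherianRing R ∧ ∃ n : ℕ, idLE R R n

/-- A regular local ring: Noetherian, and the maximal ideal is generated by `dim R` elements. -/
def IsRegularLocal [IsLocalRing R] : Prop :=
  IsNoetherianRing R ∧ ∃ s : Finset R, Ideal.span (s : Set R) = IsLocalRing.maximalIdeal R ∧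
    (s.card : WithBot ℕ∞) = ringKrullDim R

/-- A (not necessarily local) Gorenstein ring: all localizations at primes are Gorenstein. -/
def IsGorensteinRing : Prop :=
  ∀ p : PrimeSpectrum R, ∃ n : ℕ,
    idLE (Localization.AtPrime p.asIdeal) (Localization.AtPrime p.asIdeal) n

/-- `R` admits a dualizing complex; by Kawasaki's theorem this is equivalent to being a
homomorphic image of a finite-dimensional Gorenstein ring. -/
def HasDualizingComplex : Prop :=
  ∃ Q : CommRingCat.{u}, IsNoetherianRing Q ∧ ringKrullDim Q < ⊤ ∧ IsGorensteinRing Q ∧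
    ∃ f : Q →+* R, Function.Surjective f

section Cousin

/-- The product of the localizations of `N` at the primes in `S`. -/
noncomputable abbrev locProd (S : Set (PrimeSpectrum R)) (N : Type u) [AddCommGroup N]
    [Module R N] : Type u :=
  Π p : S, LocalizedModule p.1.asIdeal.primeCompl N

/-- The submodule of the product of localizations consisting of finitely supported families;
this is the direct sum `⊕_{p ∈ S} N_p`. -/
noncomputable def finSupp (S : Set (PrimeSpectrum R)) (N : Type u) [AddCommGroup N]
    [Module R N] : Submodule R (locProd R S N) where
  carrier := {f | {p : S | f p ≠ 0}.Finite}
  add_mem' := by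
    intro f g hf hg
    refine (hf.union hg).subset ?_
    intro p hp
    by_contra h
    simp only [Set.mem_union, Set.mem_setOf_eq, not_or, not_not] at h
    exact hp (by simp [Pi.add_apply, h.1, h.2])
  zero_mem' := by simp
  smul_mem' := by
    intro c f hf
    refine hf.subset ?_
    intro p hp
    by_contra h
    simp only [Set.mem_setOf_eq, not_not] at h
    exact hp (by simp [Pi.smul_apply, h])

/-- The canonical map `N → ∏_{p ∈ S} N_p`. -/
noncomputable def thetaFull (S : Set (PrimeSpectrum R)) (N : Type u) [AddCommGroup N]
    [Module R N] : N →ₗ[R] locProd R S N :=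
  LinearMap.pi fun p => LocalizedModule.mkLinearMap p.1.asIdeal.primeCompl N

/-- The cokernel of `N → ⊕_{p ∈ S} N_p` (computed inside the direct sum). -/
noncomputable abbrev nextKType (S : Set (PrimeSpectrum R)) (N : Type u) [AddCommGroup N]
    [Module R N] : Type u :=
  ↥(finSupp R S N) ⧸
    (Submodule.comap (finSupp R S N).subtype (LinearMap.range (thetaFull R S N)))

/-- The sequence of "kernel/cokernel" modules in the inductive construction
of the Cousin complex of `M` with respect to the filtration `F`. -/
noncomputable def cousinK (F : ℕ → Set (PrimeSpectrum R)) (M : ModuleCat.{u} R) :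
    ℕ → ModuleCat.{u} R
  | 0 => M
  | n + 1 => ModuleCat.of R (nextKType R (F n \ F (n + 1)) (cousinK F M n))

/-- The `n`-th term `M^n = ⊕_{p ∈ ∂F_n} (coker d^{n-2})_p` of the Cousin complex. -/
noncomputable abbrev cousinC (F : ℕ → Set (PrimeSpectrum R)) (M : ModuleCat.{u} R) (n : ℕ) :
    Type u :=
  ↥(finSupp R (F n \ F (n + 1)) (cousinK R F M n))

/-- The canonical map from the `n`-th cokernel into the product of its localizations. -/
noncomputable def cousinTheta (F : ℕ → Set (PrimeSpectrum R)) (M : ModuleCat.{u} R) (n : ℕ) :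
    (cousinK R F M n) →ₗ[R] locProd R (F n \ F (n + 1)) (cousinK R F M n) :=
  thetaFull R _ _

/-- The (full) `n`-th differential of the Cousin complex, from `M^n` to the product at
level `n+1` (it lands inside the direct sum `M^{n+1}`). -/
noncomputable def cousinD (F : ℕ → Set (PrimeSpectrum R)) (M : ModuleCat.{u} R) (n : ℕ) :
    (cousinC R F M n) →ₗ[R] locProd R (F (n + 1) \ F (n + 2)) (cousinK R F M (n + 1)) :=
  (cousinTheta R F M (n + 1)).comp
    (Submodule.mkQ (Submodule.comap (finSupp R (F n \ F (n + 1)) (cousinK R F M n)).subtype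
      (LinearMap.range (thetaFull R (F n \ F (n + 1)) (cousinK R F M n)))))

/-- `F` is a filtration of `Spec R`: descending, and every element of `∂F_n = F_n \ F_{n+1}`
is a minimal member of `F_n`. -/
def IsFiltration (F : ℕ → Set (PrimeSpectrum R)) : Prop :=
  (∀ n, F (n + 1) ⊆ F n) ∧
    ∀ n, ∀ p ∈ F n \ F (n + 1), ∀ q ∈ F n, q ≤ p → q = p

/-- The filtration `F` admits `M`. -/
def Admits (F : ℕ → Set (PrimeSpectrum R)) (M : Type u) [AddCommGroup M] [Module R M] : Prop :=
  Module.support R M ⊆ F 0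

/-- The `M`-height filtration `K_i = {p ∈ Supp M | ht_M p ≥ i}`. -/
noncomputable def heightFiltration (M : Type u) [AddCommGroup M] [Module R M] :
    ℕ → Set (PrimeSpectrum R) :=
  fun i => {p | p ∈ Module.support R M ∧ (i : ℕ∞) ≤ htM R M p}

/-- The Cousin complex `C(F, M)` is exact at `M, M⁰, …, M^t`
(together with the well-definedness of the differentials into the direct sums). -/
def CousinPartiallyExact (F : ℕ → Set (PrimeSpectrum R)) (M : ModuleCat.{u} R) (t : ℕ) : Prop :=
  (∀ n, LinearMap.range (cousinTheta R F M n) ≤ finSupp R (F n \ F (n + 1)) (cousinK R F M n)) ∧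
  Function.Injective (cousinTheta R F M 0) ∧
  (∀ n ≤ t, LinearMap.ker (cousinD R F M n) =
    Submodule.comap (finSupp R (F n \ F (n + 1)) (cousinK R F M n)).subtype
      (LinearMap.range (cousinTheta R F M n)))

/-- The Cousin complex `C(F, M)` is exact and all of its terms satisfy `P`, i.e. it provides
a `P`-resolution of `M`. -/
def CousinResolves (F : ℕ → Set (PrimeSpectrum R)) (M : ModuleCat.{u} R)
    (P : ModuleCat.{u} R → Prop) : Prop :=
  (∀ n, LinearMap.range (cousinTheta R F M n) ≤ finSupp R (F n \ F (n + 1)) (cousinK R F M n)) ∧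
  Function.Injective (cousinTheta R F M 0) ∧
  (∀ n, LinearMap.ker (cousinD R F M n) =
    Submodule.comap (finSupp R (F n \ F (n + 1)) (cousinK R F M n)).subtype
      (LinearMap.range (cousinTheta R F M n))) ∧
  (∀ n, P (ModuleCat.of R (cousinC R F M n)))

/-- A G–Gorenstein module: a nonzero finitely generated module whose Cousin complex with
respect to the `M`-height filtration is a Gorenstein injective resolution. -/
def IsGGorenstein (M : ModuleCat.{u} R) : Prop :=
  (∃ x : M, x ≠ 0) ∧ Module.Finite R M ∧
    CousinResolves R (heightFiltration R M) M (fun N => IsGorensteinInjective R N)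

/-- A Gorenstein module: a nonzero finitely generated module whose Cousin complex with
respect to the `M`-height filtration is an injective resolution. -/
def IsGorensteinModule (M : ModuleCat.{u} R) : Prop :=
  (∃ x : M, x ≠ 0) ∧ Module.Finite R M ∧
    CousinResolves R (heightFiltration R M) M (fun N => Module.Injective R N)

end Cousin

/-- A system of parameters of a local ring. -/
def IsSOP [IsLocalRing R] (rs : List R) : Prop :=
  (rs.length : WithBot ℕ∞) = ringKrullDim R ∧
    (∀ r ∈ rs, r ∈ IsLocalRing.maximalIdeal R) ∧
    IsLocalRing.maximalIdeal R ≤ (Ideal.span {r | r ∈ rs}).radical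

/-- A balanced big Cohen–Macaulay module: every system of parameters of `R` is a regular
sequence on `M`. -/
def IsBalancedBigCM [IsLocalRing R] (M : Type u) [AddCommGroup M] [Module R M] : Prop :=
  ∀ rs : List R, IsSOP R rs → RingTheory.Sequence.IsRegular M rs

end GG

namespace GGProof
open CategoryTheory Abelian

variable {R : Type u} [CommRing R]

section ExtLES

lemma sub_of_zero {A B : ModuleCat.{u} R} {i : ℕ} (h : ∀ e : Ext A B i, e = 0) :
    Subsingleton (Ext A B i) := ⟨fun a b => by rw [h a, h b]⟩

lemma cov_X₂ {S : ShortComplex (ModuleCat.{u} R)} (hS : S.ShortExact) (X : ModuleCat.{u} R)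
    {i : ℕ} (h₁ : Subsingleton (Ext X S.X₁ i)) (h₃ : Subsingleton (Ext X S.X₃ i)) :
    Subsingleton (Ext X S.X₂ i) := by
  refine ⟨fun a b => ?_⟩
  have : ∀ e : Ext X S.X₂ i, e = 0 := fun e => by
    obtain ⟨y, rfl⟩ := Ext.covariant_sequence_exact₂ X hS e (Subsingleton.elim _ _)
    rw [Subsingleton.elim y 0]; simp
  rw [this a, this b]

lemma cov_X₁ {S : ShortComplex (ModuleCat.{u} R)} (hS : S.ShortExact) (X : ModuleCat.{u} R)
    {i : ℕ} (h₃ : Subsingleton (Ext X S.X₃ i)) (h₂ : Subsingleton (Ext X S.X₂ (i + 1))) :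
    Subsingleton (Ext X S.X₁ (i + 1)) := by
  refine ⟨fun a b => ?_⟩
  have : ∀ e : Ext X S.X₁ (i + 1), e = 0 := fun e => by
    obtain ⟨y, rfl⟩ := Ext.covariant_sequence_exact₁ X hS e (Subsingleton.elim _ _) rfl
    rw [Subsingleton.elim y 0]; simp
  rw [this a, this b]

lemma cov_X₃ {S : ShortComplex (ModuleCat.{u} R)} (hS : S.ShortExact) (X : ModuleCat.{u} R)
    {i : ℕ} (h₂ : Subsingleton (Ext X S.X₂ i)) (h₁ : Subsingleton (Ext X S.X₁ (i + 1))) :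
    Subsingleton (Ext X S.X₃ i) := by
  refine ⟨fun a b => ?_⟩
  have : ∀ e : Ext X S.X₃ i, e = 0 := fun e => by
    obtain ⟨y, rfl⟩ := Ext.covariant_sequence_exact₃ X hS e rfl (Subsingleton.elim _ _)
    rw [Subsingleton.elim y 0]; simp
  rw [this a, this b]

lemma con_X₂ {S : ShortComplex (ModuleCat.{u} R)} (hS : S.ShortExact) (X : ModuleCat.{u} R)
    {i : ℕ} (h₁ : Subsingleton (Ext S.X₁ X i)) (h₃ : Subsingleton (Ext S.X₃ X i)) :
    Subsingleton (Ext S.X₂ X i) := by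
  refine ⟨fun a b => ?_⟩
  have : ∀ e : Ext S.X₂ X i, e = 0 := fun e => by
    obtain ⟨y, rfl⟩ := Ext.contravariant_sequence_exact₂ hS X e (Subsingleton.elim _ _)
    rw [Subsingleton.elim y 0]; simp
  rw [this a, this b]

lemma con_X₁ {S : ShortComplex (ModuleCat.{u} R)} (hS : S.ShortExact) (X : ModuleCat.{u} R)
    {i : ℕ} (h₂ : Subsingleton (Ext S.X₂ X i)) (h₃ : Subsingleton (Ext S.X₃ X (i + 1))) :
    Subsingleton (Ext S.X₁ X i) := by
  refine ⟨fun a b => ?_⟩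
  have : ∀ e : Ext S.X₁ X i, e = 0 := fun e => by
    obtain ⟨y, rfl⟩ := Ext.contravariant_sequence_exact₁ hS X e (add_comm 1 i)
      (Subsingleton.elim _ _)
    rw [Subsingleton.elim y 0]; simp
  rw [this a, this b]

lemma con_X₃ {S : ShortComplex (ModuleCat.{u} R)} (hS : S.ShortExact) (X : ModuleCat.{u} R)
    {i : ℕ} (h₁ : Subsingleton (Ext S.X₁ X i)) (h₂ : Subsingleton (Ext S.X₂ X (i + 1))) :
    Subsingleton (Ext S.X₃ X (i + 1)) := by
  refine ⟨fun a b => ?_⟩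
  have : ∀ e : Ext S.X₃ X (i + 1), e = 0 := fun e => by
    obtain ⟨y, rfl⟩ := Ext.contravariant_sequence_exact₃ hS X e (Subsingleton.elim _ _)
      (add_comm 1 i)
    rw [Subsingleton.elim y 0]; simp
  rw [this a, this b]

end ExtLES

lemma mk_shortExact {A B C : Type u} [AddCommGroup A] [Module R A] [AddCommGroup B] [Module R B]
    [AddCommGroup C] [Module R C] (f : A →ₗ[R] B) (g : B →ₗ[R] C) (hf : Function.Injective f)
    (hg : Function.Surjective g) (h : Function.Exact f g) :
    (ModuleCat.shortComplexOfCompEqZero f g h.linearMap_comp_eq_zero).ShortExact where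
  exact := ModuleCat.shortComplex_exact _ h
  mono_f := by
    rw [ModuleCat.mono_iff_injective]; exact hf
  epi_g := by
    rw [ModuleCat.epi_iff_surjective]; exact hg

lemma ext_iso_left {A A' : ModuleCat.{u} R} (e : A ≅ A') (B : ModuleCat.{u} R) {i : ℕ}
    (h : Subsingleton (Ext A B i)) : Subsingleton (Ext A' B i) := by
  refine ⟨fun a b => ?_⟩
  have : ∀ x : Ext A' B i, x = 0 := fun x => by
    have h1 : x = (Ext.mk₀ e.inv).comp ((Ext.mk₀ e.hom).comp x (zero_add i)) (zero_add i) := by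
      rw [Ext.mk₀_comp_mk₀_assoc]; simp
    rw [h1, Subsingleton.elim ((Ext.mk₀ e.hom).comp x (zero_add i)) 0]; simp
  rw [this a, this b]

lemma ext_iso_right {B B' : ModuleCat.{u} R} (A : ModuleCat.{u} R) (e : B ≅ B') {i : ℕ}
    (h : Subsingleton (Ext A B i)) : Subsingleton (Ext A B' i) := by
  refine ⟨fun a b => ?_⟩
  have : ∀ x : Ext A B' i, x = 0 := fun x => by
    have h1 : x = (x.comp (Ext.mk₀ e.inv) (add_zero i)).comp (Ext.mk₀ e.hom) (add_zero i) := by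
      simp
    rw [h1, Subsingleton.elim (x.comp (Ext.mk₀ e.inv) (add_zero i)) 0]; simp
  rw [this a, this b]

lemma mk₀_smul_comp {A B : ModuleCat.{u} R} (r : R) {i : ℕ} (e : Ext A B i) :
    (Ext.mk₀ (r • 𝟙 A)).comp e (zero_add i) = r • e := by
  rw [Ext.mk₀_smul, Ext.smul_comp]; simp

lemma comp_mk₀_smul {A B : ModuleCat.{u} R} (r : R) {i : ℕ} (e : Ext A B i) :
    e.comp (Ext.mk₀ (r • 𝟙 B)) (add_zero i) = r • e := by
  rw [Ext.mk₀_smul, Ext.comp_smul]; simp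

open Pointwise in
/-- Nakayama step in the first variable. -/
lemma ext_nakayama [IsLocalRing R] [IsNoetherianRing R] (A B : ModuleCat.{u} R)
    [Module.Finite R A] [Module.Finite R B] {x : R} (hx : x ∈ IsLocalRing.maximalIdeal R)
    (reg : IsSMulRegular A x) {i : ℕ}
    (h : Subsingleton (Ext (ModuleCat.of R (QuotSMulTop x A)) B (i + 1))) :
    Subsingleton (Ext A B i) := by
  have hS := reg.smulShortComplex_shortExact
  have key : ∀ e : Ext A B i, ∃ e' : Ext A B i, x • e' = e := fun e => by
    obtain ⟨y, hy⟩ := Ext.contravariant_sequence_exact₁ hS B e (add_comm 1 i)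
      (@Subsingleton.elim _ h _ _)
    exact ⟨y, (mk₀_smul_comp (A := A) x y).symm.trans hy⟩
  have : (⊤ : Submodule R (Ext A B i)) ≤ (IsLocalRing.maximalIdeal R) • ⊤ := fun e _ => by
    obtain ⟨e', rfl⟩ := key e
    exact Submodule.smul_mem_smul hx trivial
  have h2 := Submodule.eq_bot_of_le_smul_of_le_jacobson_bot (IsLocalRing.maximalIdeal R) ⊤
    (Module.Finite.fg_top) this (IsLocalRing.maximalIdeal_le_jacobson _)
  exact (Submodule.subsingleton_iff R).1 (subsingleton_of_bot_eq_top h2.symm)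

open Pointwise in
lemma ext_depth_step (A B : ModuleCat.{u} R) {x : R} (hx : ∀ a : A, x • a = 0)
    (reg : IsSMulRegular B x) {i : ℕ}
    (h : Subsingleton (Ext A (ModuleCat.of R (QuotSMulTop x B)) i)) :
    Subsingleton (Ext A B (i + 1)) := by
  have hS := reg.smulShortComplex_shortExact
  have hx0 : x • 𝟙 A = 0 := by ext a; exact hx a
  have key : ∀ e : Ext A B (i + 1), e = 0 := fun e => by
    obtain ⟨y, hy⟩ := Ext.covariant_sequence_exact₁ A hS e (by
      have : x • e = 0 := by rw [← mk₀_smul_comp, hx0]; simp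
      exact (comp_mk₀_smul x e).trans this) rfl
    have hy0 : y = 0 := @Subsingleton.elim _ h y 0
    rw [hy0, Ext.zero_comp] at hy
    exact hy.symm
  exact ⟨fun a b => by rw [key a, key b]⟩

open Pointwise in
lemma ext_zero_step (A B : ModuleCat.{u} R) {x : R} (hx : ∀ a : A, x • a = 0)
    (reg : IsSMulRegular B x) : Subsingleton (Ext A B 0) := by
  have key : ∀ e : Ext A B 0, e = 0 := fun e => by
    obtain ⟨f, rfl⟩ := Ext.mk₀_bijective _ _ |>.2 e
    have : f = 0 := by
      ext a
      apply reg
      change x • f a = x • 0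
      rw [← map_smul, hx, smul_zero, map_zero]
    rw [this]; simp
  exact ⟨fun a b => by rw [key a, key b]⟩

end GGProof

namespace GGProof
open CategoryTheory Abelian

variable {R : Type u} [CommRing R]

lemma ext_of_subsingleton_left (A B : ModuleCat.{u} R) [Subsingleton A] (i : ℕ) :
    Subsingleton (Ext A B i) := by
  apply sub_of_zero
  intro e
  have h : 𝟙 A = 0 := by ext a; exact Subsingleton.elim _ _
  rw [← Ext.mk₀_id_comp e, h]; simp

/-- Dévissage to prime cyclic modules. -/
lemma ext_filtration [IsNoetherianRing R] (X : ModuleCat.{u} R) (i : ℕ) (N : Type u)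
    [AddCommGroup N] [Module R N] (hN : Module.Finite R N) :
    (∀ p : Ideal R, p.IsPrime → Module.annihilator R N ≤ p →
      Subsingleton (Ext (ModuleCat.of R (R ⧸ p)) X i)) →
    Subsingleton (Ext (ModuleCat.of R N) X i) := by
  refine IsNoetherianRing.induction_on_isQuotientEquivQuotientPrime R hN
    (motive := fun N _ _ _ => (∀ p : Ideal R, p.IsPrime → Module.annihilator R N ≤ p →
      Subsingleton (Ext (ModuleCat.of R (R ⧸ p)) X i)) →
      Subsingleton (Ext (ModuleCat.of R N) X i)) ?_ ?_ ?_
  · intro N _ _ _ _ _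
    exact ext_of_subsingleton_left (ModuleCat.of R N) X i
  · intro N _ _ _ p e h
    have := h p.1 p.2 (by rw [e.annihilator_eq, Ideal.annihilator_quotient])
    exact ext_iso_left e.symm.toModuleIso X this
  · intro N₁ _ _ _ N₂ _ _ _ N₃ _ _ _ f g hf hg hfg h1 h3 h
    exact con_X₂ (mk_shortExact f g hf hg hfg) X
      (h1 fun p hp hle => h p hp ((f.annihilator_le_of_injective hf).trans hle))
      (h3 fun p hp hle => h p hp ((g.annihilator_le_of_surjective hg).trans hle))

open Pointwise in
lemma ischebeck [IsLocalRing R] [IsNoetherianRing R] (X : ModuleCat.{u} R) [Module.Finite R X]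
    (h : ∀ i : ℕ, (i : ℕ∞) < (IsLocalRing.maximalIdeal R).height →
      Subsingleton (Ext (ModuleCat.of R (R ⧸ IsLocalRing.maximalIdeal R)) X i))
    (q : Ideal R) : q.IsPrime → ∀ i : ℕ, (i : ℕ∞) < q.height →
      Subsingleton (Ext (ModuleCat.of R (R ⧸ q)) X i) := by
  induction q using WellFoundedGT.induction with
  | ind q ih =>
  intro hq i hi
  by_cases hqm : q = IsLocalRing.maximalIdeal R
  · subst hqm; exact h i hi
  have hlt : q < IsLocalRing.maximalIdeal R :=
    lt_of_le_of_ne (IsLocalRing.le_maximalIdeal hq.ne_top) hqm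
  obtain ⟨y, hym, hyq⟩ := SetLike.exists_of_lt hlt
  have reg : IsSMulRegular (R ⧸ q) y := by
    refine IsSMulRegular.of_right_eq_zero_of_smul ?_
    intro x hx
    obtain ⟨x, rfl⟩ := Ideal.Quotient.mk_surjective x
    rw [Algebra.smul_def] at hx
    change Ideal.Quotient.mk q y * _ = 0 at hx
    rw [← map_mul, Ideal.Quotient.eq_zero_iff_mem] at hx
    exact Ideal.Quotient.eq_zero_iff_mem.2 ((hq.mem_or_mem hx).resolve_left hyq)
  refine ext_nakayama (ModuleCat.of R (R ⧸ q)) X hym reg ?_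
  refine ext_filtration X (i + 1) _ inferInstance ?_
  intro p hp hle
  have hqp : q ≤ p := by
    refine le_trans ?_ hle
    intro a ha
    rw [Module.mem_annihilator]
    intro m
    obtain ⟨m, rfl⟩ := Submodule.Quotient.mk_surjective _ m
    obtain ⟨m, rfl⟩ := Ideal.Quotient.mk_surjective m
    rw [← Submodule.Quotient.mk_smul, Algebra.smul_def]
    change Submodule.Quotient.mk (Ideal.Quotient.mk q a * _) = 0
    rw [Ideal.Quotient.eq_zero_iff_mem.2 ha, zero_mul]; rfl
  have hyp : y ∈ p := by
    apply hle
    rw [Module.mem_annihilator]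
    intro m
    obtain ⟨m, rfl⟩ := Submodule.Quotient.mk_surjective _ m
    rw [← Submodule.Quotient.mk_smul, Submodule.Quotient.mk_eq_zero]
    exact Submodule.smul_mem_pointwise_smul _ _ _ trivial
  have hlt : q < p := lt_of_le_of_ne hqp (by rintro rfl; exact hyq hyp)
  refine ih p hlt hp (i + 1) ?_
  have := Ideal.height_add_one_le_of_lt_of_isPrime hlt
  refine lt_of_lt_of_le ?_ this
  push_cast
  exact (ENat.add_lt_add_iff_right ENat.one_ne_top).2 hi

open Pointwise RingTheory.Sequence in
lemma common_regular [IsNoetherianRing R] (n : ℕ) : ∀ (X Y : Type u) [AddCommGroup X] [Module R X]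
    [AddCommGroup Y] [Module R Y] [Module.Finite R X] [Module.Finite R Y] (q : Ideal R),
    (∀ q' : Ideal R, q'.IsPrime → q ≤ q' → ∀ i < n,
      Subsingleton (Ext (ModuleCat.of R (R ⧸ q')) (ModuleCat.of R X) i) ∧
      Subsingleton (Ext (ModuleCat.of R (R ⧸ q')) (ModuleCat.of R Y) i)) →
    ∃ rs : List R, rs.length = n ∧ (∀ r ∈ rs, r ∈ q) ∧ IsWeaklyRegular X rs ∧
      IsWeaklyRegular Y rs := by
  induction n with
  | zero => intro X Y _ _ _ _ _ _ q _; exact ⟨[], rfl, by simp, by simp, by simp⟩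
  | succ n ih =>
    intro X Y _ _ _ _ _ _ q h
    have ass : ∀ (Z : Type u) [AddCommGroup Z] [Module R Z], 
        ∀ p : Ideal R, p.IsPrime → q ≤ p →
        Subsingleton (Ext (ModuleCat.of R (R ⧸ p)) (ModuleCat.of R Z) 0) →
        p ∉ associatedPrimes R Z := by
      intro Z _ _ p hp hqp hs hass
      obtain ⟨f, hf⟩ := (isAssociatedPrime_iff_exists_injective_linearMap _ _).1 hass |>.2
      have e : Ext.mk₀ (ModuleCat.ofHom f) = 0 := Subsingleton.elim _ _
      have e2 : ModuleCat.ofHom f = 0 := (Ext.mk₀_bijective _ _).1 (e.trans (Ext.mk₀_zero _ _).symm)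
      have : f 1 = 0 := by
        have := congrArg (fun g => g.hom 1) e2
        exact this
      have h1 := hf (this.trans (map_zero f).symm)
      exact hp.ne_top ((Ideal.eq_top_iff_one _).2 (Ideal.Quotient.eq_zero_iff_mem.1 h1))
    obtain ⟨x, hxq, hx⟩ : ∃ x ∈ q, x ∉ ⋃ p ∈ associatedPrimes R X ∪ associatedPrimes R Y,
        (p : Set R) := by
      by_contra! hcon
      have hsub : (q : Set R) ⊆ ⋃ p ∈ associatedPrimes R X ∪ associatedPrimes R Y, (p : Set R) :=
        fun x hx => hcon x hx
      have hfin : (associatedPrimes R X ∪ associatedPrimes R Y).Finite :=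
        (associatedPrimes.finite R X).union (associatedPrimes.finite R Y)
      obtain ⟨p, hp, hqp⟩ := (Ideal.subset_union_prime_finite hfin (f := fun p => p) ⊥ ⊥
        (by rintro p (hp | hp) _ _ <;> exact hp.isPrime)).1 hsub
      rcases hp with hp | hp
      · exact ass X p hp.isPrime hqp ((h p hp.isPrime hqp 0 (by omega)).1) hp
      · exact ass Y p hp.isPrime hqp ((h p hp.isPrime hqp 0 (by omega)).2) hp
    have regX : IsSMulRegular X x := by
      by_contra hc
      have : x ∈ ⋃ p ∈ associatedPrimes R X, (p : Set R) := by
        rw [biUnion_associatedPrimes_eq_compl_regular]; exact hc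
      exact hx (Set.biUnion_subset_biUnion_left Set.subset_union_left this)
    have regY : IsSMulRegular Y x := by
      by_contra hc
      have : x ∈ ⋃ p ∈ associatedPrimes R Y, (p : Set R) := by
        rw [biUnion_associatedPrimes_eq_compl_regular]; exact hc
      exact hx (Set.biUnion_subset_biUnion_left Set.subset_union_right this)
    obtain ⟨rs, hl, hm, hX, hY⟩ := ih (QuotSMulTop x X) (QuotSMulTop x Y) q (by
      intro q' hq' hqq' i hi
      have h1 := h q' hq' hqq' i (by omega)
      have h2 := h q' hq' hqq' (i + 1) (by omega)
      have hSX := IsSMulRegular.smulShortComplex_shortExact (M := ModuleCat.of R X) regX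
      have hSY := IsSMulRegular.smulShortComplex_shortExact (M := ModuleCat.of R Y) regY
      exact ⟨cov_X₃ hSX (ModuleCat.of R (R ⧸ q')) h1.1 h2.1,
        cov_X₃ hSY (ModuleCat.of R (R ⧸ q')) h1.2 h2.2⟩)
    refine ⟨x :: rs, by simp [hl], ?_, ?_, ?_⟩
    · intro r hr
      rcases List.mem_cons.1 hr with rfl | hr
      · exact hxq
      · exact hm r hr
    · exact IsWeaklyRegular.cons regX hX
    · exact IsWeaklyRegular.cons regY hY

open RingTheory.Sequence in
/-- If `rs ⊆ q` is a regular sequence of length `ht q` then `R/q` embeds in `R/(rs)`. -/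
lemma embed_quotient [IsNoetherianRing R] (q : Ideal R) [hq : q.IsPrime] (rs : List R)
    (hm : ∀ r ∈ rs, r ∈ q) (hreg : IsWeaklyRegular R rs) (hlen : (rs.length : ℕ∞) = q.height) :
    ∃ f : (R ⧸ q) →ₗ[R] (R ⧸ Ideal.ofList rs), Function.Injective f := by
  have hle : Ideal.ofList rs ≤ q := Ideal.span_le.2 hm
  obtain ⟨q', hq', hqq'⟩ := Ideal.exists_minimalPrimes_le hle
  have hp' := hq'.isPrime
  have hle' : Ideal.ofList rs ≤ q' := hq'.1.2
  have hreg' := hreg.isRegular_of_isLocalization_of_mem (Localization.AtPrime q') q'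
    (fun r hr => hle' (Ideal.subset_span hr))
  have hd := ringKrullDim_add_length_eq_ringKrullDim_of_isRegular _ hreg'
  rw [IsLocalization.AtPrime.ringKrullDim_eq_height q' (Localization.AtPrime q'), List.length_map] at hd
  have hge : (rs.length : ℕ∞) ≤ q'.height := by
    have hnt : Nontrivial (Localization.AtPrime q' ⧸
        Ideal.ofList (rs.map (algebraMap R (Localization.AtPrime q')))) := by
      apply Ideal.Quotient.nontrivial_iff.2
      have := hreg'.top_ne_smul
      simpa using this.symm
    have h0 := ringKrullDim_nonneg_of_nontrivial (R := Localization.AtPrime q' ⧸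
        Ideal.ofList (rs.map (algebraMap R (Localization.AtPrime q'))))
    have : ((rs.length : ℕ∞) : WithBot ℕ∞) ≤ (q'.height : WithBot ℕ∞) := by
      rw [← hd]
      calc ((rs.length : ℕ∞) : WithBot ℕ∞) = 0 + (rs.length : WithBot ℕ∞) := by simp
        _ ≤ _ := by gcongr
    exact_mod_cast this
  have heq : q' = q := by
    by_contra hne
    have hlt : q' < q := lt_of_le_of_ne hqq' hne
    have h1 := Ideal.height_add_one_le_of_lt_of_isPrime hlt
    rw [← hlen] at h1
    have h2 : (rs.length : ℕ∞) + 1 ≤ rs.length := (by gcongr : _ ≤ q'.height + 1).trans h1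
    have h3 : rs.length + 1 ≤ rs.length := by exact_mod_cast h2
    omega
  subst heq
  have hass : q' ∈ associatedPrimes R (R ⧸ Ideal.ofList rs) := by
    apply Module.associatedPrimes.minimalPrimes_annihilator_subset_associatedPrimes R
    rwa [Ideal.annihilator_quotient]
  exact ((isAssociatedPrime_iff_exists_injective_linearMap _ _).1 hass).2

end GGProof

namespace GGProof
open CategoryTheory Abelian

/-- A bounded homological functor with the properties of `Tor(F, -)`, `F` of finite flat
dimension. -/
structure TorData (R : Type u) [CommRing R] where
  H : ℕ → ModuleCat.{u} R ⥤ ModuleCat.{u} R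
  hsmul : ∀ (i : ℕ) (L : ModuleCat.{u} R) (r : R), (H i).map (r • 𝟙 L) = r • 𝟙 ((H i).obj L)
  δ : ∀ (S : ShortComplex (ModuleCat.{u} R)) (_ : S.ShortExact) (i : ℕ),
    (H (i + 1)).obj S.X₃ ⟶ (H i).obj S.X₁
  ex₁ : ∀ (S : ShortComplex (ModuleCat.{u} R)) (hS : S.ShortExact) (i : ℕ)
    (w : (H i).obj S.X₁), (H i).map S.f w = 0 → ∃ v, δ S hS i v = w
  ex₂ : ∀ (S : ShortComplex (ModuleCat.{u} R)) (_ : S.ShortExact) (i : ℕ)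
    (w : (H i).obj S.X₂), (H i).map S.g w = 0 → ∃ v, (H i).map S.f v = w
  ex₃ : ∀ (S : ShortComplex (ModuleCat.{u} R)) (hS : S.ShortExact) (i : ℕ)
    (w : (H (i + 1)).obj S.X₃), δ S hS i w = 0 → ∃ v, (H (i + 1)).map S.g v = w
  bound : ℕ
  bounded : ∀ i, bound < i → ∀ L, Subsingleton ((H i).obj L)
  free : ∀ i, 0 < i → Subsingleton ((H i).obj (ModuleCat.of R R))

namespace TorData
variable {R : Type u} [CommRing R] (D : TorData R)

lemma iso {L L' : ModuleCat.{u} R} (e : L ≅ L') {i : ℕ} (h : Subsingleton ((D.H i).obj L)) :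
    Subsingleton ((D.H i).obj L') :=
  ((D.H i).mapIso e).toLinearEquiv.symm.toEquiv.subsingleton

lemma smul_elt (L : ModuleCat.{u} R) (i : ℕ) (r : R) (z : (D.H i).obj L) :
    (D.H i).map (r • 𝟙 L) z = r • z := by
  rw [D.hsmul]; rfl

lemma kill (L : ModuleCat.{u} R) (i : ℕ) (r : R) (h : ∀ l : L, r • l = 0)
    (z : (D.H i).obj L) : r • z = 0 := by
  rw [← D.smul_elt]
  have h1 : r • 𝟙 L = (0 : R) • 𝟙 L := by
    ext l; change r • l = (0 : R) • l; rw [h, zero_smul]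
  rw [h1, D.smul_elt, zero_smul]

open Pointwise in
lemma quot_vanish (L : ModuleCat.{u} R) {x : R} (reg : IsSMulRegular L x) {k : ℕ}
    (h : ∀ i, k < i → Subsingleton ((D.H i).obj L)) (i : ℕ) (hi : k + 1 < i) :
    Subsingleton ((D.H i).obj (ModuleCat.of R (QuotSMulTop x L))) := by
  have hS := reg.smulShortComplex_shortExact
  obtain ⟨i, rfl⟩ : ∃ j, i = j + 1 := ⟨i - 1, by omega⟩
  have h1 := h i (by omega)
  have h2 := h (i + 1) (by omega)
  have key : ∀ w : (D.H (i + 1)).obj (ModuleCat.of R (QuotSMulTop x L)), w = 0 := fun w => by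
    obtain ⟨v, hv⟩ := D.ex₃ _ hS i w (@Subsingleton.elim _ h1 _ _)
    have hv0 : v = 0 := @Subsingleton.elim _ h2 _ _
    rw [hv0, map_zero] at hv
    exact hv.symm
  exact ⟨fun a b => by rw [key a, key b]⟩

open Pointwise RingTheory.Sequence in
lemma quot_list_vanish (rs : List R) : ∀ (L : ModuleCat.{u} R) (k : ℕ), IsWeaklyRegular L rs →
    (∀ i, k < i → Subsingleton ((D.H i).obj L)) → ∀ i, k + rs.length < i →
    Subsingleton ((D.H i).obj (ModuleCat.of R (L ⧸ (Ideal.ofList rs • ⊤ : Submodule R L)))) := by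
  induction rs with
  | nil =>
    intro L k _ h i hi
    refine D.iso ?_ (h i (by simpa using hi))
    exact (Submodule.quotEquivOfEqBot (Ideal.ofList [] • ⊤ : Submodule R L)
      (by simp)).symm.toModuleIso
  | cons x rs ih =>
    intro L k hreg h i hi
    rw [isWeaklyRegular_cons_iff] at hreg
    have := ih (ModuleCat.of R (QuotSMulTop x L)) (k + 1) hreg.2
      (D.quot_vanish L hreg.1 h) i (by simp at hi; omega)
    exact D.iso (Submodule.quotOfListConsSMulTopEquivQuotSMulTopInner L x rs).symm.toModuleIso this

open Pointwise RingTheory.Sequence in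
lemma embed_shift (p : Ideal R) (rs : List R) : ∀ (L : ModuleCat.{u} R) (s : ℕ),
    IsWeaklyRegular L rs → (∀ r ∈ rs, r ∈ p) →
    (∀ i, s < i → Subsingleton ((D.H i).obj L)) →
    (∃ z : (D.H s).obj L, ∀ r : R, r • z = 0 ↔ r ∈ p) →
    ∃ z : (D.H (s + rs.length)).obj
      (ModuleCat.of R (L ⧸ (Ideal.ofList rs • ⊤ : Submodule R L))), ∀ r : R, r • z = 0 ↔ r ∈ p := by
  have iso_z : ∀ {L L' : ModuleCat.{u} R} (e : L ≅ L') {i : ℕ}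
      (_ : ∃ z : (D.H i).obj L, ∀ r : R, r • z = 0 ↔ r ∈ p),
      ∃ z : (D.H i).obj L', ∀ r : R, r • z = 0 ↔ r ∈ p := by
    rintro L L' e i ⟨z, hz⟩
    let e' := ((D.H i).mapIso e).toLinearEquiv
    refine ⟨e' z, fun r => ?_⟩
    rw [← hz, ← map_smul, LinearEquiv.map_eq_zero_iff]
  induction rs with
  | nil =>
    intro L s _ _ h hz
    exact iso_z (Submodule.quotEquivOfEqBot (Ideal.ofList [] • ⊤ : Submodule R L)
      (by simp)).symm.toModuleIso hz
  | cons x rs ih =>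
    intro L s hreg hm h ⟨z, hz⟩
    rw [isWeaklyRegular_cons_iff] at hreg
    have hS := hreg.1.smulShortComplex_shortExact
    obtain ⟨v, hv⟩ := D.ex₁ _ hS s z ((D.smul_elt L s x z).trans ((hz x).2 (hm x (by simp))))
    have inj : ∀ v, D.δ _ hS s v = 0 → v = 0 := fun v hv => by
      obtain ⟨u, hu⟩ := D.ex₃ _ hS s v hv
      have hu0 : u = 0 := @Subsingleton.elim _ (h (s + 1) (by omega)) _ _
      rw [hu0, map_zero] at hu
      exact hu.symm
    have := ih (ModuleCat.of R (QuotSMulTop x L)) (s + 1) hreg.2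
      (fun r hr => hm r (by simp [hr])) (D.quot_vanish L hreg.1 h) ⟨v, fun r => by
        rw [← hz r]
        constructor
        · intro hr
          have h0 := congrArg (D.δ _ hS s) hr
          have h0 := h0.trans (map_zero (D.δ _ hS s).hom)
          rw [← hv]
          exact (map_smul (D.δ _ hS s).hom r v).symm.trans h0
        · intro hr
          apply inj
          exact (map_smul (D.δ _ hS s).hom r v).trans ((congrArg (r • ·) hv).trans hr)⟩
    have h3 := iso_z (Submodule.quotOfListConsSMulTopEquivQuotSMulTopInner L x rs).symm.toModuleIso this
    rw [List.length_cons, add_comm rs.length, ← add_assoc]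
    exact h3

open Pointwise RingTheory.Sequence in
lemma claim [IsNoetherianRing R]
    (hreg : ∀ q : Ideal R, q.IsPrime → ∃ rs : List R, (rs.length : ℕ∞) = q.height ∧
      (∀ r ∈ rs, r ∈ q) ∧ IsWeaklyRegular R rs) (p : Ideal R) [hp : p.IsPrime] (j : ℕ) :
    ∀ i : ℕ, D.bound < i + j → p.height < i → ∀ (L : Type u) [AddCommGroup L] [Module R L],
    Module.Finite R L → ∀ z : (D.H i).obj (ModuleCat.of R L), ∃ y ∉ p, y • z = 0 := by
  have h1p : (1 : R) ∉ p := fun h => hp.ne_top ((Ideal.eq_top_iff_one _).2 h)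
  induction j with
  | zero =>
    intro i hi _ L _ _ _ z
    exact ⟨1, h1p, @Subsingleton.elim _ (D.bounded i hi _) _ _⟩
  | succ j ih =>
    intro i hi hht L _ _ hL
    refine IsNoetherianRing.induction_on_isQuotientEquivQuotientPrime R hL
      (motive := fun L _ _ _ => ∀ z : (D.H i).obj (ModuleCat.of R L), ∃ y ∉ p, y • z = 0) ?_ ?_ ?_
    · intro N _ _ _ _ z
      exact ⟨1, h1p, D.kill _ _ 1 (fun l => @Subsingleton.elim N _ _ _) z⟩
    · intro N _ _ _ q e z
      by_cases hqp : q.1 ≤ p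
      · obtain ⟨rs, hlen, hm, hr⟩ := hreg q.1 q.2
        have := q.2
        obtain ⟨f, hf⟩ := embed_quotient q.1 rs hm hr hlen
        let f' : N →ₗ[R] (R ⧸ (Ideal.ofList rs • ⊤ : Submodule R R)) :=
          (Submodule.quotEquivOfEq (Ideal.ofList rs) (Ideal.ofList rs • ⊤ : Submodule R R)
            (by simp)).toLinearMap ∘ₗ f ∘ₗ e.toLinearMap
        have hf' : Function.Injective f' := by
          simp only [f', LinearMap.coe_comp, LinearEquiv.coe_coe]
          exact (LinearEquiv.injective _).comp (hf.comp e.injective)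
        have hS := mk_shortExact f' (LinearMap.range f').mkQ hf'
          (Submodule.mkQ_surjective _) (LinearMap.exact_map_mkQ_range f')
        have hvan := D.quot_list_vanish rs (ModuleCat.of R R) 0 hr D.free i (by
          have h1 : (rs.length : ℕ∞) < i := by
            rw [hlen]; exact (Ideal.height_mono hqp).trans_lt hht
          have h2 : rs.length < i := by exact_mod_cast h1
          omega)
        obtain ⟨v, hv⟩ := D.ex₁ _ hS i z (@Subsingleton.elim _ hvan _ _)
        obtain ⟨y, hy, hyv⟩ := ih (i + 1) (by omega)
          (hht.trans (by exact_mod_cast Nat.lt_succ_self i)) _ inferInstance v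
        refine ⟨y, hy, ?_⟩
        rw [← hv]
        refine (map_smul (D.δ _ hS i).hom y v).symm.trans ?_
        refine (congrArg (D.δ _ hS i).hom hyv).trans (map_zero _)
      · obtain ⟨y, hyq, hyp⟩ := SetLike.not_le_iff_exists.1 hqp
        refine ⟨y, hyp, D.kill _ _ y (fun l => ?_) z⟩
        have : y ∈ Module.annihilator R N := by
          rw [e.annihilator_eq, Ideal.annihilator_quotient]; exact hyq
        exact Module.mem_annihilator.1 this l
    · intro N₁ _ _ _ N₂ _ _ _ N₃ _ _ _ f g hf hg hfg h1 h3 z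
      have hS := mk_shortExact f g hf hg hfg
      obtain ⟨y₃, hy₃, hyz⟩ := h3 ((D.H i).map (ModuleCat.ofHom g) z)
      obtain ⟨v, hv⟩ := D.ex₂ _ hS i (y₃ • z)
        ((map_smul ((D.H i).map (ModuleCat.ofHom g)).hom y₃ z).trans hyz)
      obtain ⟨y₁, hy₁, hyv⟩ := h1 v
      refine ⟨y₁ * y₃, fun h => (hp.mem_or_mem h).elim hy₁ hy₃, ?_⟩
      rw [mul_smul, ← hv]
      refine (map_smul ((D.H i).map (ModuleCat.ofHom f)).hom y₁ v).symm.trans ?_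
      exact (congrArg ((D.H i).map (ModuleCat.ofHom f)).hom hyv).trans (map_zero _)

open Pointwise RingTheory.Sequence in
theorem main [IsNoetherianRing R] (T : Type u) [AddCommGroup T] [Module R T] [Module.Finite R T]
    (hreg : ∀ q : Ideal R, q.IsPrime → ∃ rs : List R, (rs.length : ℕ∞) = q.height ∧
      (∀ r ∈ rs, r ∈ q) ∧ IsWeaklyRegular T rs ∧ IsWeaklyRegular R rs) (i : ℕ) (hi : 0 < i) :
    Subsingleton ((D.H i).obj (ModuleCat.of R T)) := by
  have hstep : ∀ s, 0 < s → (∀ i, s < i → Subsingleton ((D.H i).obj (ModuleCat.of R T))) →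
      Subsingleton ((D.H s).obj (ModuleCat.of R T)) := by
    intro s hs h
    by_contra hcon
    rw [not_subsingleton_iff_nontrivial] at hcon
    obtain ⟨p, hp⟩ := associatedPrimes.nonempty R ((D.H s).obj (ModuleCat.of R T))
    have hprime := hp.isPrime
    obtain ⟨f, hf⟩ := ((isAssociatedPrime_iff_exists_injective_linearMap _ _).1 hp).2
    have hz : ∃ z : (D.H s).obj (ModuleCat.of R T), ∀ r : R, r • z = 0 ↔ r ∈ p := by
      refine ⟨f 1, fun r => ?_⟩
      rw [← map_smul, map_eq_zero_iff f hf, Algebra.smul_def, mul_one]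
      exact Ideal.Quotient.eq_zero_iff_mem
    obtain ⟨rs, hlen, hm, hT, _⟩ := hreg p hprime
    obtain ⟨z, hz⟩ := D.embed_shift p rs (ModuleCat.of R T) s hT hm h hz
    obtain ⟨y, hy, hyz⟩ := D.claim (fun q hq => by
      obtain ⟨rs, h1, h2, h3, h4⟩ := hreg q hq
      exact ⟨rs, h1, h2, h4⟩) p (D.bound + 1) (s + rs.length) (by omega) (by
        rw [← hlen]
        exact_mod_cast (by omega : rs.length < s + rs.length)) _ inferInstance z
    exact hy ((hz y).1 hyz)
  have hall : ∀ k, ∀ i, 0 < i → D.bound < i + k → Subsingleton ((D.H i).obj (ModuleCat.of R T)) := by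
    intro k
    induction k with
    | zero => intro i _ hi; exact D.bounded i hi _
    | succ k ih => 
      intro i hi hb
      exact hstep i hi fun i' hi' => ih i' (by omega) (by omega)
  exact hall (D.bound + 1) i hi (by omega)

end TorData
end GGProof

namespace GGProof
open CategoryTheory Abelian TensorProduct

section
variable {R : Type u} [CommRing R] (G : ℕ → ModuleCat.{u} R) (d : ∀ i, G (i + 1) →ₗ[R] G i)
  (hd : ∀ i, (d i).comp (d (i + 1)) = 0)

/-- The complex `G ⊗ L`. -/
noncomputable def tensCplx (L : ModuleCat.{u} R) : ChainComplex (ModuleCat.{u} R) ℕ :=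
  ChainComplex.of (fun i => ModuleCat.of R (G i ⊗[R] L))
    (fun i => ModuleCat.ofHom ((d i).rTensor L)) (fun i => by
      rw [← ModuleCat.ofHom_comp, ← LinearMap.rTensor_comp, hd, LinearMap.rTensor_zero]; rfl)

lemma tensCplx_d (L : ModuleCat.{u} R) (i : ℕ) :
    (tensCplx G d hd L).d (i + 1) i = ModuleCat.ofHom ((d i).rTensor L) :=
  ChainComplex.of_d (fun i => ModuleCat.of R (G i ⊗[R] L)) (fun i => ModuleCat.ofHom ((d i).rTensor L)) i

noncomputable def tensMap {L L' : ModuleCat.{u} R} (f : L ⟶ L') :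
    tensCplx G d hd L ⟶ tensCplx G d hd L' :=
  ChainComplex.ofHom (X := tensCplx G d hd L) (Y := tensCplx G d hd L')
    (fun i => ModuleCat.ofHom (f.hom.lTensor (G i))) (fun i => by
      rw [tensCplx_d, tensCplx_d]
      refine ModuleCat.hom_ext ?_
      change ((d i).rTensor L').comp (f.hom.lTensor (G (i+1))) = (f.hom.lTensor (G i)).comp ((d i).rTensor L)
      rw [LinearMap.rTensor_comp_lTensor, LinearMap.lTensor_comp_rTensor])

noncomputable def tensFunctor : ModuleCat.{u} R ⥤ ChainComplex (ModuleCat.{u} R) ℕ where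
  obj L := tensCplx G d hd L
  map f := tensMap G d hd f
  map_id L := by
    ext i : 1
    refine ModuleCat.hom_ext ?_
    exact LinearMap.lTensor_id _ _
  map_comp f g := by
    ext i : 1
    refine ModuleCat.hom_ext ?_
    exact LinearMap.lTensor_comp _ _ _

instance : (tensFunctor G d hd).PreservesZeroMorphisms where
  map_zero L L' := by
    ext i : 1
    refine ModuleCat.hom_ext ?_
    exact LinearMap.lTensor_zero _

lemma tens_shortExact (hflat : ∀ i, Module.Flat R (G i)) (S : ShortComplex (ModuleCat.{u} R))
    (hS : S.ShortExact) : (S.map (tensFunctor G d hd)).ShortExact := by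
  apply HomologicalComplex.shortExact_of_degreewise_shortExact
  intro i
  have := hflat i
  have h1 : Function.Exact S.f.hom S.g.hom :=
    (ShortComplex.ShortExact.moduleCat_exact_iff_function_exact S).1 hS.exact
  exact mk_shortExact (S.f.hom.lTensor (G i)) (S.g.hom.lTensor (G i))
    (Module.Flat.lTensor_preserves_injective_linearMap _ hS.moduleCat_injective_f)
    (LinearMap.lTensor_surjective _ hS.moduleCat_surjective_g)
    (lTensor_exact _ h1 hS.moduleCat_surjective_g)

lemma tens_exactAt_iff (L : ModuleCat.{u} R) (i : ℕ) :
    Subsingleton ((tensCplx G d hd L).homology (i + 1)) ↔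
      ∀ w : G (i + 1) ⊗[R] L, (d i).rTensor L w = 0 → ∃ v, (d (i + 1)).rTensor L v = w := by
  rw [← ModuleCat.isZero_iff_subsingleton, ← HomologicalComplex.exactAt_iff_isZero_homology,
    HomologicalComplex.exactAt_iff' _ (i + 2) (i + 1) i (by simp) (by simp),
    ShortComplex.moduleCat_exact_iff]
  have h1 := tensCplx_d G d hd L i
  have h2 := tensCplx_d G d hd L (i + 1)
  simp only [HomologicalComplex.shortComplexFunctor'_obj_f,
    HomologicalComplex.shortComplexFunctor'_obj_g]
  rw [h1, h2]
  rfl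

noncomputable def torData (n : ℕ) (hflat : ∀ i, Module.Flat R (G i))
    (hex : ∀ i (w : G (i + 1)), d i w = 0 → ∃ v, d (i + 1) v = w)
    (hn : ∀ i, n < i → ∀ x : G i, x = 0) : TorData R where
  H i := tensFunctor G d hd ⋙ HomologicalComplex.homologyFunctor _ _ i
  hsmul i L r := by
    have h : (tensFunctor G d hd).map (r • 𝟙 L) = r • 𝟙 _ := by
      ext j : 1
      refine ModuleCat.hom_ext ?_
      refine (LinearMap.lTensor_smul _ r (LinearMap.id)).trans ?_
      rw [LinearMap.lTensor_id]; rfl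
    rw [Functor.comp_map, h]
    refine (ShortComplex.homologyMap_smul
      (𝟙 (((tensFunctor G d hd).obj L).sc i)) r).trans ?_
    rw [ShortComplex.homologyMap_id]; rfl
  δ S hS i := (tens_shortExact G d hd hflat S hS).δ (i + 1) i rfl
  ex₁ S hS i w hw := by
    have := (tens_shortExact G d hd hflat S hS).homology_exact₁ (i + 1) i rfl
    exact (ShortComplex.moduleCat_exact_iff _).1 this w hw
  ex₂ S hS i w hw := by
    have := (tens_shortExact G d hd hflat S hS).homology_exact₂ i
    exact (ShortComplex.moduleCat_exact_iff _).1 this w hw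
  ex₃ S hS i w hw := by
    have := (tens_shortExact G d hd hflat S hS).homology_exact₃ (i + 1) i rfl
    exact (ShortComplex.moduleCat_exact_iff _).1 this w hw
  bound := n
  bounded i hi L := by
    obtain ⟨i, rfl⟩ : ∃ j, i = j + 1 := ⟨i - 1, by omega⟩
    refine (tens_exactAt_iff G d hd L i).2 fun w _ => ⟨0, ?_⟩
    have : Subsingleton (G (i + 1)) := ⟨fun a b => by rw [hn _ hi a, hn _ hi b]⟩
    exact Subsingleton.elim _ _
  free i hi := by
    obtain ⟨i, rfl⟩ : ∃ j, i = j + 1 := ⟨i - 1, by omega⟩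
    refine (tens_exactAt_iff G d hd (ModuleCat.of R R) i).2 fun w hw => ?_
    have h1 : Function.Exact (d (i + 1)) (d i) := fun w =>
      ⟨fun h => hex i w h, by rintro ⟨v, rfl⟩; exact LinearMap.congr_fun (hd i) v⟩
    have h2 := Module.Flat.rTensor_exact R h1
    exact (h2 w).1 hw

end

/-- Diagram chase: exactness of `G ⊗ T` at `1` gives injectivity of `F ⊗ K → F ⊗ P`. -/
lemma lTensor_inj_of_exact {R : Type u} [CommRing R] {G0 G1 G2 F K P T : Type u}
    [AddCommGroup G0] [Module R G0] [AddCommGroup G1] [Module R G1] [AddCommGroup G2] [Module R G2]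
    [AddCommGroup F] [Module R F] [AddCommGroup K] [Module R K] [AddCommGroup P] [Module R P]
    [AddCommGroup T] [Module R T] [Module.Flat R G0]
    (d0 : G1 →ₗ[R] G0) (d1 : G2 →ₗ[R] G1) (hd : d0.comp d1 = 0) (ε : G0 →ₗ[R] F)
    (hε : Function.Surjective ε) (hex : Function.Exact d0 ε)
    (f : K →ₗ[R] P) (g : P →ₗ[R] T) (hf : Function.Injective f) (hg : Function.Surjective g)
    (hfg : Function.Exact f g)
    (h : ∀ w : G1 ⊗[R] T, d0.rTensor T w = 0 → ∃ v, d1.rTensor T v = w) :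
    Function.Injective (f.lTensor F) := by
  rw [injective_iff_map_eq_zero]
  intro x hx
  obtain ⟨y, rfl⟩ := LinearMap.rTensor_surjective K hε x
  have comm : ∀ {A B C D : Type u} [AddCommGroup A] [Module R A] [AddCommGroup B] [Module R B]
      [AddCommGroup C] [Module R C] [AddCommGroup D] [Module R D] (a : A →ₗ[R] B) (c : C →ₗ[R] D)
      (z : A ⊗[R] C), c.lTensor B (a.rTensor C z) = a.rTensor D (c.lTensor A z) := by
    intro A B C D _ _ _ _ _ _ _ _ a c z
    have := LinearMap.lTensor_comp_rTensor (M := A) (P := B) (N := C) (Q := D) (f := a) (g := c)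
    have h2 := LinearMap.rTensor_comp_lTensor (M := A) (P := B) (N := C) (Q := D) (f := a) (g := c)
    exact LinearMap.congr_fun (this.trans h2.symm) z
  rw [comm] at hx
  obtain ⟨w, hw⟩ := (rTensor_exact P hex hε _).1 hx
  have h1 : d0.rTensor T (g.lTensor G1 w) = 0 := by
    rw [← comm, hw, ← LinearMap.comp_apply, ← LinearMap.lTensor_comp,
      hfg.linearMap_comp_eq_zero, LinearMap.lTensor_zero]; rfl
  obtain ⟨v, hv⟩ := h _ h1
  obtain ⟨v', rfl⟩ := LinearMap.lTensor_surjective G2 hg v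
  have h2 : g.lTensor G1 (w - d1.rTensor P v') = 0 := by
    rw [map_sub, comm, hv, sub_self]
  obtain ⟨z, hz⟩ := (lTensor_exact G1 hfg hg _).1 h2
  have h3 : f.lTensor G0 (d0.rTensor K z) = f.lTensor G0 y := by
    rw [comm, hz, map_sub, hw, ← LinearMap.comp_apply, ← LinearMap.rTensor_comp, hd,
      LinearMap.rTensor_zero]
    simp
  have h4 := Module.Flat.lTensor_preserves_injective_linearMap (M := G0) f hf h3
  rw [← h4, ← LinearMap.comp_apply, ← LinearMap.rTensor_comp, hex.linearMap_comp_eq_zero,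
    LinearMap.rTensor_zero]; rfl

open MonoidalCategory in
lemma tor_one_of_inj {R : Type u} [CommRing R] (F T : ModuleCat.{u} R)
    (h : ∀ (K P : Type u) [AddCommGroup K] [Module R K] [AddCommGroup P] [Module R P]
      (f : K →ₗ[R] P) (g : P →ₗ[R] T), Function.Injective f → Function.Surjective g →
      Function.Exact f g → Function.Injective (f.lTensor F)) :
    Subsingleton (((Tor (ModuleCat.{u} R) 1).obj F).obj T) := by
  let P := projectiveResolution T
  refine (P.isoLeftDerivedObj ((tensoringLeft (ModuleCat.{u} R)).obj F) 1).toLinearEquiv.toEquiv.subsingleton_congr.2 ?_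
  rw [← ModuleCat.isZero_iff_subsingleton]
  refine (HomologicalComplex.exactAt_iff_isZero_homology _ _).1 ?_
  rw [HomologicalComplex.exactAt_iff' _ 2 1 0 (by simp) (by simp), ShortComplex.moduleCat_exact_iff]
  let d0 : P.complex.X 1 →ₗ[R] P.complex.X 0 := (P.complex.d 1 0).hom
  let d1 : P.complex.X 2 →ₗ[R] P.complex.X 1 := (P.complex.d 2 1).hom
  change ∀ w : F ⊗[R] P.complex.X 1, d0.lTensor F w = 0 → ∃ v, d1.lTensor F v = w
  have e0 := (ShortComplex.moduleCat_exact_iff _).1 P.exact₀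
  have e1 := (ShortComplex.moduleCat_exact_iff _).1 (P.exact_succ 0)
  have hz0 : ∀ x, (P.π.f 0).hom (d0 x) = 0 := fun x => 
    congrArg (fun q => q.hom x) P.complex_d_comp_π_f_zero
  have hz1 : ∀ x, d0 (d1 x) = 0 := fun x => 
    congrArg (fun q => q.hom x) (P.complex.d_comp_d 2 1 0)
  let g : P.complex.X 0 →ₗ[R] T := (P.π.f 0).hom
  have hg : Function.Surjective g := (ModuleCat.epi_iff_surjective _).1 (inferInstanceAs (Epi (P.π.f 0)))
  have hinj := h (LinearMap.range d0) (P.complex.X 0) (LinearMap.range d0).subtype g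
    (Submodule.subtype_injective _) hg (by
      intro x
      constructor
      · intro hx
        obtain ⟨y, hy⟩ := e0 x hx
        exact ⟨⟨x, y, hy⟩, rfl⟩
      · rintro ⟨⟨_, y, rfl⟩, rfl⟩
        exact hz0 y)
  have hex : Function.Exact d1 d0.rangeRestrict := by
    intro x
    constructor
    · intro hx
      exact e1 x (congrArg Subtype.val hx)
    · rintro ⟨y, rfl⟩
      exact Subtype.ext (hz1 y)
  intro w hw
  have hw2 : (LinearMap.range d0).subtype.lTensor F (d0.rangeRestrict.lTensor F w) = 0 := by
    rw [← LinearMap.comp_apply, ← LinearMap.lTensor_comp]; exact hw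
  have hw3 := hinj (hw2.trans (map_zero _).symm)
  exact (lTensor_exact F hex d0.surjective_rangeRestrict w).1 hw3

open RingTheory.Sequence in
theorem tor_vanish {R : Type u} [CommRing R] [IsNoetherianRing R] 
    (T : Type u) [AddCommGroup T] [Module R T] [Module.Finite R T]
    (hreg : ∀ q : Ideal R, q.IsPrime → ∃ rs : List R, (rs.length : ℕ∞) = q.height ∧
      (∀ r ∈ rs, r ∈ q) ∧ IsWeaklyRegular T rs ∧ IsWeaklyRegular R rs)
    (F : ModuleCat.{u} R) (n : ℕ) (G : ℕ → ModuleCat.{u} R) (d : ∀ i : ℕ, G (i + 1) →ₗ[R] G i)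
    (ε : G 0 →ₗ[R] F) (hflat : ∀ i, Module.Flat R (G i)) (hε : Function.Surjective ε)
    (h0 : LinearMap.ker ε = LinearMap.range (d 0))
    (hs : ∀ i, LinearMap.ker (d i) = LinearMap.range (d (i + 1)))
    (hn : ∀ i, n < i → ∀ x : G i, x = 0) :
    Subsingleton (((Tor (ModuleCat.{u} R) 1).obj F).obj (ModuleCat.of R T)) := by
  have hd : ∀ i, (d i).comp (d (i + 1)) = 0 := fun i => 
    LinearMap.range_le_ker_iff.1 (hs i).ge
  have hex : ∀ i (w : G (i + 1)), d i w = 0 → ∃ v, d (i + 1) v = w := fun i w hw => by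
    have : w ∈ LinearMap.range (d (i + 1)) := by rw [← hs]; exact hw
    exact this
  have hv := (torData G d hd n hflat hex hn).main T hreg 1 one_pos
  have hv := (tens_exactAt_iff G d hd (ModuleCat.of R T) 0).1 hv
  apply tor_one_of_inj
  intro K P _ _ _ _ f g hf hg hfg
  have := hflat 0
  exact lTensor_inj_of_exact (d 0) (d 1) (hd 0) ε hε (LinearMap.exact_iff.2 h0) f g hf hg hfg hv
end GGProof

namespace GGProof
open CategoryTheory Abelian

variable {R : Type u} [CommRing R]

open RingTheory.Sequence IsLocalRing

lemma hreg_of_ext [IsLocalRing R] [IsNoetherianRing R] (T : Type u) [AddCommGroup T] [Module R T]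
    [Module.Finite R T]
    (hT : ∀ i : ℕ, (i : ℕ∞) < (maximalIdeal R).height →
      Subsingleton (Ext (ModuleCat.of R (R ⧸ maximalIdeal R)) (ModuleCat.of R T) i))
    (hR : ∀ i : ℕ, (i : ℕ∞) < (maximalIdeal R).height →
      Subsingleton (Ext (ModuleCat.of R (R ⧸ maximalIdeal R)) (ModuleCat.of R R) i))
    (q : Ideal R) (hq : q.IsPrime) : ∃ rs : List R, (rs.length : ℕ∞) = q.height ∧
      (∀ r ∈ rs, r ∈ q) ∧ IsWeaklyRegular T rs ∧ IsWeaklyRegular R rs := by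
  have hfin : q.height ≠ ⊤ := Ideal.height_ne_top hq.ne_top
  obtain ⟨n, hn⟩ := ENat.ne_top_iff_exists.1 hfin
  obtain ⟨rs, h1, h2, h3, h4⟩ := common_regular n T R q (fun q' hq' hle i hi => by
    have : (i : ℕ∞) < q'.height := lt_of_lt_of_le (by rw [← hn]; exact_mod_cast hi) (Ideal.height_mono hle)
    exact ⟨ischebeck (ModuleCat.of R T) hT q' hq' i this, ischebeck (ModuleCat.of R R) hR q' hq' i this⟩)
  exact ⟨rs, by rw [h1, hn], h2, h3, h4⟩

lemma ext_k_vanish [IsLocalRing R] (rs : List R) : ∀ (X : Type u) [AddCommGroup X] [Module R X],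
    (∀ r ∈ rs, r ∈ maximalIdeal R) → IsWeaklyRegular X rs → ∀ i < rs.length,
      Subsingleton (Ext (ModuleCat.of R (R ⧸ maximalIdeal R)) (ModuleCat.of R X) i) := by
  induction rs with
  | nil => intro X _ _ _ _ i hi; simp at hi
  | cons r rs ih =>
    intro X _ _ hm hreg i hi
    rw [isWeaklyRegular_cons_iff] at hreg
    have hk : ∀ a : (ModuleCat.of R (R ⧸ maximalIdeal R)), r • a = 0 := by
      intro a
      obtain ⟨a, rfl⟩ := Ideal.Quotient.mk_surjective a
      change Ideal.Quotient.mk _ (r * a) = 0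
      exact Ideal.Quotient.eq_zero_iff_mem.2 (Ideal.mul_mem_right _ _ (hm r (by simp)))
    cases i with
    | zero => exact ext_zero_step _ _ hk hreg.1
    | succ i =>
      exact ext_depth_step _ _ hk hreg.1 (ih _ (fun s hs => hm s (by simp [hs])) hreg.2 i
        (by simpa using hi))

section GInj
variable (X : ℤ → ModuleCat.{u} R) (d : ∀ n : ℤ, X n →ₗ[R] X (n + 1))
  (hd : ∀ n, LinearMap.range (d n) = LinearMap.ker (d (n + 1)))

def dres (hd : ∀ n, LinearMap.range (d n) = LinearMap.ker (d (n + 1))) (n : ℤ) :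
    X n →ₗ[R] LinearMap.ker (d (n + 1)) :=
  (d n).codRestrict _ (fun x => by rw [← hd]; exact ⟨x, rfl⟩)

lemma dres_surj (n : ℤ) : Function.Surjective (dres X d hd n) := by
  rintro ⟨y, hy⟩
  rw [← hd] at hy
  obtain ⟨x, rfl⟩ := hy
  exact ⟨x, rfl⟩

lemma dres_exact (n : ℤ) : Function.Exact (LinearMap.ker (d n)).subtype (dres X d hd n) := by
  intro x
  constructor
  · intro hx
    exact ⟨⟨x, congrArg Subtype.val hx⟩, rfl⟩
  · rintro ⟨⟨y, hy⟩, rfl⟩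
    exact Subtype.ext hy

lemma gses (n : ℤ) : (ModuleCat.shortComplexOfCompEqZero (LinearMap.ker (d n)).subtype
    (dres X d hd n) (dres_exact X d hd n).linearMap_comp_eq_zero).ShortExact :=
  mk_shortExact _ _ (Submodule.subtype_injective _) (dres_surj X d hd n) (dres_exact X d hd n)

lemma ext_inj_right (A B : ModuleCat.{u} R) (hB : Module.Injective R B) (i : ℕ) :
    Subsingleton (Ext A B (i + 1)) := by
  have : Injective B := (Module.injective_iff_injective_object R B).1 hB
  exact sub_of_zero fun e => Ext.eq_zero_of_injective e

lemma ginj_inj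
    (hX : ∀ n, Module.Injective R (X n))
    (hd : ∀ n, LinearMap.range (d n) = LinearMap.ker (d (n + 1)))
    (hlift : ∀ (I : ModuleCat.{u} R), Module.Injective R I →
      ∀ (n : ℤ) (φ : I →ₗ[R] X (n + 1)), (d (n + 1)).comp φ = 0 →
        ∃ ψ : I →ₗ[R] X n, (d n).comp ψ = φ)
    (I : ModuleCat.{u} R) (hI : Module.Injective R I) (i : ℕ) : ∀ n : ℤ, 
    Subsingleton (Ext I (ModuleCat.of R (LinearMap.ker (d n))) (i + 1)) := by
  induction i with
  | zero =>
    intro n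
    apply sub_of_zero
    intro e
    obtain ⟨φ, hφ⟩ := Ext.covariant_sequence_exact₁ I (gses X d hd n) e 
      (@Subsingleton.elim _ (ext_inj_right I (X n) (hX n) 0) _ _) rfl
    obtain ⟨φ, rfl⟩ := (Ext.mk₀_bijective _ _).2 φ
    obtain ⟨ψ, hψ⟩ := hlift I hI n ((LinearMap.ker (d (n + 1))).subtype.comp φ.hom) (by
      ext x; exact (φ.hom x).2)
    have : φ = ModuleCat.ofHom ψ ≫ ModuleCat.ofHom (dres X d hd n) := by
      ext x
      exact (LinearMap.congr_fun hψ x).symm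
    rw [← hφ, this, ← Ext.mk₀_comp_mk₀, Ext.comp_assoc_of_second_deg_zero]
    have := (gses X d hd n).comp_extClass
    erw [this]
    simp
  | succ i ih =>
    intro n
    exact cov_X₁ (gses X d hd n) I (ih (n + 1)) (ext_inj_right I (X n) (hX n) _)

lemma ginj_fid
    (hX : ∀ n, Module.Injective R (X n))
    (hd : ∀ n, LinearMap.range (d n) = LinearMap.ker (d (n + 1)))
    (hlift : ∀ (I : ModuleCat.{u} R), Module.Injective R I →
      ∀ (n : ℤ) (φ : I →ₗ[R] X (n + 1)), (d (n + 1)).comp φ = 0 →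
        ∃ ψ : I →ₗ[R] X n, (d n).comp ψ = φ)
    (k : ℕ) : ∀ (A : ModuleCat.{u} R), HasInjectiveDimensionLT A k → ∀ (i : ℕ) (n : ℤ),
    Subsingleton (Ext A (ModuleCat.of R (LinearMap.ker (d n))) (i + 1)) := by
  induction k with
  | zero =>
    intro A hA i n
    have := isZero_of_hasInjectiveDimensionLT_zero A
    rw [ModuleCat.isZero_iff_subsingleton] at this
    exact ext_of_subsingleton_left A _ _
  | succ k ih =>
    intro A hA i n
    cases k with
    | zero =>
      have : Injective A := injective_iff_hasInjectiveDimensionLT_one.2 hA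
      exact ginj_inj X d hX hd hlift A ((Module.injective_iff_injective_object R A).2 this) i n
    | succ k =>
      let S : ShortComplex (ModuleCat.{u} R) := ShortComplex.mk (Injective.ι A) (Limits.cokernel.π (Injective.ι A)) (by simp)
      have hS : S.ShortExact := { exact := ShortComplex.exact_cokernel _ }
      have hQ := (hS.hasInjectiveDimensionLT_X₃_iff k (inferInstanceAs (Injective (Injective.under A)))).2 hA
      refine con_X₁ hS _ ?_ (ih _ hQ (i + 1) n)
      exact ginj_inj X d hX hd hlift (Injective.under A) ((Module.injective_iff_injective_object R (Injective.under A : ModuleCat.{u} R)).2 (inferInstanceAs (Injective (Injective.under A)))) i n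
end GInj

lemma fid_of_cores (M : Type u) [AddCommGroup M] [Module R M] (n : ℕ) (G : ℕ → ModuleCat.{u} R)
    (d : ∀ i : ℕ, G i →ₗ[R] G (i + 1)) (ε : M →ₗ[R] G 0)
    (hG : ∀ i, Module.Injective R (G i)) (hε : Function.Injective ε)
    (h0 : LinearMap.range ε = LinearMap.ker (d 0))
    (hd : ∀ i, LinearMap.range (d i) = LinearMap.ker (d (i + 1)))
    (hn : ∀ i, n < i → ∀ x : G i, x = 0) : ∃ k, HasInjectiveDimensionLT (ModuleCat.of R M) k := by
  have key : ∀ k j, n < j + k → HasInjectiveDimensionLT (ModuleCat.of R (LinearMap.ker (d j))) k := by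
    intro k
    induction k with
    | zero =>
      intro j hj
      have : Subsingleton (LinearMap.ker (d j)) := ⟨fun a b => Subtype.ext (by rw [hn j hj a.1, hn j hj b.1])⟩
      apply Limits.IsZero.hasInjectiveDimensionLT_zero
      exact ModuleCat.isZero_of_subsingleton _
    | succ k ih =>
      intro j hj
      have hS := mk_shortExact (LinearMap.ker (d j)).subtype 
        ((d j).codRestrict (LinearMap.ker (d (j + 1))) (fun x => by rw [← hd]; exact ⟨x, rfl⟩)) 
        (Submodule.subtype_injective _) (by
          rintro ⟨y, hy⟩
          rw [← hd] at hy
          obtain ⟨x, rfl⟩ := hy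
          exact ⟨x, rfl⟩) (by
          intro x
          constructor
          · intro hx
            exact ⟨⟨x, congrArg Subtype.val hx⟩, rfl⟩
          · rintro ⟨⟨y, hy⟩, rfl⟩
            exact Subtype.ext hy)
      refine hS.hasInjectiveDimensionLT_X₁ k (ih (j + 1) (by omega)) ?_
      have : Injective (G j) := (Module.injective_iff_injective_object R _).1 (hG j)
      have : HasInjectiveDimensionLT (G j) 1 := injective_iff_hasInjectiveDimensionLT_one.1 this
      exact hasInjectiveDimensionLT_of_ge (G j) 1 (k + 1) (by omega)
  refine ⟨n + 1, ?_⟩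
  have := key (n + 1) 0 (by omega)
  let e : M ≃ₗ[R] LinearMap.ker (d 0) := (LinearEquiv.ofInjective ε hε).trans (LinearEquiv.ofEq _ _ h0)
  exact hasInjectiveDimensionLT_of_iso (LinearEquiv.toModuleIso e.symm) _
end GGProof

namespace GGProof
open CategoryTheory Abelian

variable {R : Type u} [CommRing R]

open RingTheory.Sequence IsLocalRing

lemma ext_of_subsingleton_right (A B : ModuleCat.{u} R) (hB : Subsingleton B) (i : ℕ) :
    Subsingleton (Ext A B i) := by
  apply sub_of_zero
  intro e
  have h : 𝟙 B = 0 := by ext a; exact Subsingleton.elim _ _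
  rw [← Ext.comp_mk₀_id e, h]; simp

def FinId (A : ModuleCat.{u} R) : Prop := ∃ k, HasInjectiveDimensionLT A k

lemma finId_quot (A : ModuleCat.{u} R) (hA : FinId A) (x : R) (reg : IsSMulRegular A x) :
    FinId (ModuleCat.of R (QuotSMulTop x A)) := by
  obtain ⟨k, hk⟩ := hA
  refine ⟨k, reg.smulShortComplex_shortExact.hasInjectiveDimensionLT_X₃ k hk ?_⟩
  exact hasInjectiveDimensionLT_of_ge A k (k + 1) (by omega)

lemma nakayama_chain [IsLocalRing R] [IsNoetherianRing R] (N : ModuleCat.{u} R) [Module.Finite R N]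
    (t : ℕ) (hN : ∀ A : ModuleCat.{u} R, FinId A → ∀ i, t < i → Subsingleton (Ext A N i))
    (rs : List R) : ∀ (A : ModuleCat.{u} R), Module.Finite R A → FinId A → 
      (∀ r ∈ rs, r ∈ maximalIdeal R) → IsWeaklyRegular A rs → ∀ i, t < i + rs.length →
      Subsingleton (Ext A N i) := by
  induction rs with
  | nil => intro A _ hA _ _ i hi; exact hN A hA i (by simpa using hi)
  | cons r rs ih =>
    intro A hf hA hm hreg i hi
    rw [isWeaklyRegular_cons_iff] at hreg
    have : Module.Finite R (QuotSMulTop r A) := Module.Finite.of_surjective _ (Submodule.mkQ_surjective _)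
    refine ext_nakayama A N (hm r (by simp)) hreg.1 ?_
    exact ih (ModuleCat.of R (QuotSMulTop r A)) this (finId_quot A hA r hreg.1) 
      (fun s hs => hm s (by simp [hs])) hreg.2 (i + 1) (by simp at hi; omega)

def Decomp (R : Type u) [CommRing R] [IsLocalRing R] (D : Type u) [AddCommGroup D] [Module R D] : Prop :=
  ∃ (s : Finset R) (σ : R → D →ₗ[R] D), (∀ y ∈ s, y ∈ maximalIdeal R) ∧ ∀ x, ∑ y ∈ s, y • σ y x = x

lemma Decomp.hom [IsLocalRing R] {D : Type u} [AddCommGroup D] [Module R D] (h : Decomp R D)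
    (M : Type u) [AddCommGroup M] [Module R M] : Decomp R (M →ₗ[R] D) := by
  obtain ⟨s, σ, hs, h⟩ := h
  refine ⟨s, fun y => LinearMap.compRight R (σ y), hs, fun φ => ?_⟩
  ext m
  simpa [LinearMap.sum_apply] using h (φ m)

lemma Decomp.ext [IsLocalRing R] {D : Type u} [AddCommGroup D] [Module R D] (h : Decomp R D) (i : ℕ) :
    Subsingleton (Ext (ModuleCat.of R (R ⧸ maximalIdeal R)) (ModuleCat.of R D) i) := by
  obtain ⟨s, σ, hs, h⟩ := h
  apply sub_of_zero
  intro e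
  have hid : 𝟙 (ModuleCat.of R D) = ∑ y ∈ s, y • ModuleCat.ofHom (σ y) := by
    ext x
    have : (∑ y ∈ s, y • ModuleCat.ofHom (σ y)).hom = ∑ y ∈ s, y • σ y := by
      rw [ModuleCat.hom_sum]; rfl
    rw [this]
    simpa using (h x).symm
  have h0 : ∀ y ∈ s, ∀ e' : Ext (ModuleCat.of R (R ⧸ maximalIdeal R)) (ModuleCat.of R D) i,
      y • e' = 0 := by
    intro y hy e'
    have : y • 𝟙 (ModuleCat.of R (R ⧸ maximalIdeal R)) = 0 := by
      ext
      change Ideal.Quotient.mk _ (y * 1) = 0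
      exact Ideal.Quotient.eq_zero_iff_mem.2 (Ideal.mul_mem_right _ _ (hs y hy))
    rw [← mk₀_smul_comp, this]; simp
  rw [← Ext.comp_mk₀_id e, hid, ← Finset.sum_coe_sort s, Ext.mk₀_sum, Ext.comp_sum]
  refine Finset.sum_eq_zero fun y _ => ?_
  rw [Ext.mk₀_smul, Ext.comp_smul]
  exact h0 y y.2 _

section Chain
variable (K C : ℕ → ModuleCat.{u} R) (f : ∀ j, K j →ₗ[R] C j) (g : ∀ j, C j →ₗ[R] K (j + 1))
  (hf : ∀ j, Function.Injective (f j)) (hg : ∀ j, Function.Surjective (g j))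
  (hfg : ∀ j, Function.Exact (f j) (g j))

lemma chain_vanish (hf : ∀ j, Function.Injective (f j)) (hg : ∀ j, Function.Surjective (g j))
    (hfg : ∀ j, Function.Exact (f j) (g j)) (A : ModuleCat.{u} R) 
    (hC : ∀ i j, Subsingleton (Ext A (C j) (i + 1))) (t : ℕ) (hK : Subsingleton (K (t + 1))) (k : ℕ) : 
    ∀ j, j + k = t + 1 → ∀ i, k ≤ i → Subsingleton (Ext A (K j) i) := by
  induction k with
  | zero => 
    intro j hj i _
    obtain rfl : j = t + 1 := by omega
    exact ext_of_subsingleton_right _ _ hK i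
  | succ k ih =>
    intro j hj i hi
    obtain ⟨i, rfl⟩ : ∃ i', i = i' + 1 := ⟨i - 1, by omega⟩
    exact cov_X₁ (mk_shortExact _ _ (hf j) (hg j) (hfg j)) A (ih (j + 1) (by omega) i (by omega)) (hC i j)

lemma hom_ses_surj (hf : ∀ j, Function.Injective (f j)) (hg : ∀ j, Function.Surjective (g j))
    (hfg : ∀ j, Function.Exact (f j) (g j)) (M : ModuleCat.{u} R) (j : ℕ)
    (h : Subsingleton (Ext M (K j) 1)) :
    Function.Surjective (LinearMap.compRight R (g j) : (M →ₗ[R] C j) →ₗ[R] (M →ₗ[R] K (j + 1))) := by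
  intro φ
  obtain ⟨e, he⟩ := Ext.covariant_sequence_exact₃ M (mk_shortExact _ _ (hf j) (hg j) (hfg j)) 
    (Ext.mk₀ (ModuleCat.ofHom φ)) rfl (@Subsingleton.elim _ h _ _)
  obtain ⟨ψ, rfl⟩ := (Ext.mk₀_bijective _ _).2 e
  rw [Ext.mk₀_comp_mk₀] at he
  have := (Ext.mk₀_bijective _ _).1 he
  refine ⟨ψ.hom, ?_⟩
  exact congrArg ModuleCat.Hom.hom this

lemma hom_depth [IsLocalRing R] (hf : ∀ j, Function.Injective (f j)) (hg : ∀ j, Function.Surjective (g j))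
    (hfg : ∀ j, Function.Exact (f j) (g j)) (M : ModuleCat.{u} R) 
    (hM : ∀ j, Subsingleton (Ext M (K j) 1)) (d : ℕ) (hD : ∀ j < d, Decomp R (C j)) (i : ℕ) :
    ∀ j, i + j < d → Subsingleton (Ext (ModuleCat.of R (R ⧸ maximalIdeal R))
      (ModuleCat.of R (M →ₗ[R] K j)) i) := by
  have hinj : ∀ j, Function.Injective (LinearMap.compRight R (f j) : (M →ₗ[R] K j) →ₗ[R] (M →ₗ[R] C j)) := by
    intro j φ ψ h
    ext m
    exact hf j (LinearMap.congr_fun h m)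
  have hS : ∀ j, _ := fun j => mk_shortExact (LinearMap.compRight R (f j) : (M →ₗ[R] K j) →ₗ[R] (M →ₗ[R] C j))
    (LinearMap.compRight R (g j) : (M →ₗ[R] C j) →ₗ[R] (M →ₗ[R] K (j + 1))) (hinj j)
    (hom_ses_surj K C f g hf hg hfg M j (hM j)) (by
      intro φ
      constructor
      · intro h
        have h1 : ∀ m, φ m ∈ LinearMap.range (f j) := fun m => (hfg j _).1 (LinearMap.congr_fun h m)
        refine ⟨(LinearEquiv.ofInjective (f j) (hf j)).symm.toLinearMap.comp (φ.codRestrict _ h1), ?_⟩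
        ext m
        have := LinearEquiv.apply_symm_apply (LinearEquiv.ofInjective (f j) (hf j)) ((φ.codRestrict _ h1) m)
        exact congrArg Subtype.val this
      · rintro ⟨ψ, rfl⟩
        ext m
        exact (hfg j _).2 ⟨ψ m, rfl⟩)
  induction i with
  | zero =>
    intro j hj
    have h2 := ((hD j (by omega)).hom M).ext 0
    apply sub_of_zero
    intro e
    obtain ⟨φ, rfl⟩ := (Ext.mk₀_bijective _ _).2 e
    have := (hS j).mono_f
    have h3 := (Ext.mk₀_bijective _ _).1 (@Subsingleton.elim _ h2
      (Ext.mk₀ (φ ≫ ModuleCat.ofHom (LinearMap.compRight R (f j)))) (Ext.mk₀ 0))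
    have h4 : φ = 0 := by
      refine (cancel_mono (ModuleCat.shortComplexOfCompEqZero (LinearMap.compRight R (f j))
        (LinearMap.compRight R (g j)) _).f).1 (h3.trans ?_)
      rw [Limits.zero_comp]
    rw [h4]; simp
  | succ i ih =>
    intro j hj
    exact cov_X₁ (hS j) _ (ih (j + 1) (by omega)) (((hD j (by omega)).hom M).ext _)

lemma chain_main [IsLocalRing R] [IsNoetherianRing R] (hf : ∀ j, Function.Injective (f j))
    (hg : ∀ j, Function.Surjective (g j)) (hfg : ∀ j, Function.Exact (f j) (g j)) 
    (hK0 : Module.Finite R (K 0))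
    (hC : ∀ A, FinId A → ∀ i j, Subsingleton (Ext A (C j) (i + 1)))
    (t d : ℕ) (htd : t ≤ d) (hK : Subsingleton (K (t + 1)))
    (hD : ∀ j < t, t = d → Decomp R (C j))
    (M : ModuleCat.{u} R) (hM : Module.Finite R M) (hfid : FinId M) (rs : List R)
    (hrs : ∀ r ∈ rs, r ∈ maximalIdeal R) (hreg : IsWeaklyRegular M rs) (hlen : rs.length = d) 
    (i : ℕ) (hi : i < d) :
    Subsingleton (Ext (ModuleCat.of R (R ⧸ maximalIdeal R)) (ModuleCat.of R (M →ₗ[R] K 0)) i) := by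
  have h1 := nakayama_chain (K 0) t (fun A hA i hi => chain_vanish K C f g hf hg hfg A (hC A hA) t hK (t + 1)
    0 (by omega) i hi) rs M hM hfid hrs hreg
  rcases htd.lt_or_eq with h | h
  · have h2 := h1 0 (by omega)
    apply ext_of_subsingleton_right
    refine ⟨fun φ ψ => ?_⟩
    have := (Ext.mk₀_bijective _ _).1 (@Subsingleton.elim _ h2 (Ext.mk₀ (ModuleCat.ofHom φ)) 
      (Ext.mk₀ (ModuleCat.ofHom ψ)))
    exact congrArg ModuleCat.Hom.hom this
  · have h2 : ∀ j i, Subsingleton (Ext M (K j) (i + 1)) := by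
      intro j
      induction j with
      | zero => intro i; exact h1 (i + 1) (by omega)
      | succ j ih => 
        intro i
        exact cov_X₃ (mk_shortExact _ _ (hf j) (hg j) (hfg j)) M (hC M hfid i j) (ih (i + 1))
    exact hom_depth K C f g hf hg hfg M (fun j => h2 j 0) d (fun j hj => hD j (by omega) h) i 0 (by omega)
end Chain
end GGProof

namespace GGProof
open CategoryTheory Abelian

variable {R : Type u} [CommRing R]

open RingTheory.Sequence IsLocalRing GG

lemma exists_seq [IsLocalRing R] (M : Type u) [AddCommGroup M] [Module R M] (d : ℕ)
    (h : mdepth R M = d) : ∃ rs : List R, rs.length = d ∧ (∀ r ∈ rs, r ∈ maximalIdeal R) ∧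
      IsWeaklyRegular M rs := by
  cases d with
  | zero => exact ⟨[], rfl, by simp, by simp⟩
  | succ d =>
    have h1 : (d : ℕ∞) < mdepth R M := by rw [h]; exact_mod_cast Nat.lt_succ_self d
    obtain ⟨c, ⟨rs, rfl, hm, hr⟩, hc⟩ := lt_sSup_iff.1 h1
    have h2 : (rs.length : ℕ∞) ≤ mdepth R M := le_sSup ⟨rs, rfl, hm, hr⟩
    rw [h] at h2
    refine ⟨rs, ?_, hm, hr.toIsWeaklyRegular⟩
    have h3 : d < rs.length := by exact_mod_cast hc
    have h4 : rs.length ≤ d + 1 := by exact_mod_cast h2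
    omega

lemma decomp_finSupp [IsLocalRing R] [IsNoetherianRing R] (S : Set (PrimeSpectrum R))
    (hS : ∀ p ∈ S, ¬ maximalIdeal R ≤ p.asIdeal) (N : Type u) [AddCommGroup N] [Module R N] :
    Decomp R (finSupp R S N) := by
  classical
  obtain ⟨s, hs⟩ := IsNoetherian.noetherian (maximalIdeal R)
  have ha : ∀ p : S, ∃ a ∈ s, a ∉ p.1.asIdeal := by
    intro p
    by_contra hcon
    push Not at hcon
    apply hS p.1 p.2
    rw [← hs]
    exact Submodule.span_le.2 hcon
  choose a ha1 ha2 using ha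
  have hu : ∀ p : S, ∃ u : LocalizedModule p.1.asIdeal.primeCompl N →ₗ[R]
      LocalizedModule p.1.asIdeal.primeCompl N, ∀ x, a p • u x = x := by
    intro p
    obtain ⟨u, hu⟩ := IsLocalizedModule.map_units
      (LocalizedModule.mkLinearMap p.1.asIdeal.primeCompl N) (⟨a p, ha2 p⟩ : p.1.asIdeal.primeCompl)
    refine ⟨(↑u⁻¹ : Module.End R _), fun x => ?_⟩
    have h1 := u.mul_inv
    rw [hu] at h1
    exact LinearMap.congr_fun h1 x
  choose u hu using hu
  let τ : R → locProd R S N →ₗ[R] locProd R S N := fun y =>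
    LinearMap.pi fun p => (if a p = y then u p else 0).comp (LinearMap.proj p)
  have hτ : ∀ y, ∀ f ∈ finSupp R S N, τ y f ∈ finSupp R S N := by
    intro y f hf
    refine Set.Finite.subset hf ?_
    intro p hp hfp
    apply hp
    change (if a p = y then u p else 0) (f p) = 0
    rw [hfp, map_zero]
  refine ⟨s, fun y => (τ y).restrict (hτ y), fun y hy => ?_, fun x => ?_⟩
  · rw [← hs]; exact Submodule.subset_span hy
  · apply Subtype.ext
    funext p
    have : ((∑ y ∈ s, y • (τ y).restrict (hτ y) x : finSupp R S N) : locProd R S N) =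
        ∑ y ∈ s, y • τ y x := by
      rw [Submodule.coe_sum]; rfl
    rw [this, Finset.sum_apply, Finset.sum_eq_single (a p)]
    · change a p • (if a p = a p then u p else 0) (x.1 p) = x.1 p
      rw [if_pos rfl, hu]
    · intro y _ hy
      change y • (if a p = y then u p else 0) (x.1 p) = 0
      rw [if_neg (Ne.symm hy)]; simp
    · intro h; exact absurd (ha1 p) h

lemma theta_inj (F : ℕ → Set (PrimeSpectrum R)) (N : ModuleCat.{u} R) 
    (h0 : Function.Injective (cousinTheta R F N 0))
    (h : ∀ n, LinearMap.ker (cousinD R F N n) =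
    Submodule.comap (finSupp R (F n \ F (n + 1)) (cousinK R F N n)).subtype
      (LinearMap.range (cousinTheta R F N n))) (j : ℕ) : Function.Injective (cousinTheta R F N j) := by
  cases j with
  | zero => exact h0
  | succ n =>
    rw [injective_iff_map_eq_zero]
    intro y hy
    obtain ⟨x, rfl⟩ := Submodule.mkQ_surjective _ y
    have hx : x ∈ LinearMap.ker (cousinD R F N n) := hy
    rw [h] at hx
    exact (Submodule.Quotient.mk_eq_zero _).2 hx

lemma ginj_ext (X : ModuleCat.{u} R) (hX : IsGorensteinInjective R X) (A : ModuleCat.{u} R)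
    (hA : FinId A) (i : ℕ) : Subsingleton (Ext A X (i + 1)) := by
  obtain ⟨Y, d, h1, h2, h3, ⟨e⟩⟩ := hX
  obtain ⟨k, hk⟩ := hA
  exact ext_iso_right A (LinearEquiv.toModuleIso e.symm) (ginj_fid Y d h1 h2 h3 k A hk i 0)

lemma htM_eq (N : Type u) [AddCommGroup N] [Module R N] (p : PrimeSpectrum R)
    (h : p ∈ Module.support R N) : 
    htM R N p = Order.height (⟨p, h⟩ : ↥(Module.support R N)) := by
  unfold htM; rw [iSup_pos h]

lemma htM_mono (N : Type u) [AddCommGroup N] [Module R N] (p q : PrimeSpectrum R)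
    (h : p ∈ Module.support R N) (h' : q ∈ Module.support R N) (hpq : p ≤ q) : 
    htM R N p ≤ htM R N q := by
  rw [htM_eq N p h, htM_eq N q h']
  exact Order.height_mono hpq

lemma htM_le (N : Type u) [AddCommGroup N] [Module R N] (p : PrimeSpectrum R)
    (h : p ∈ Module.support R N) : htM R N p ≤ p.asIdeal.height := by
  rw [htM_eq N p h, PrimeSpectrum.height_eq_orderHeight]
  exact Order.height_le_height_apply_of_strictMono (Subtype.val) (fun _ _ h => h) _

lemma hom_ext_k [IsLocalRing R] [IsNoetherianRing R] (N : ModuleCat.{u} R) (hN : IsGGorenstein R N)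
    (M : ModuleCat.{u} R) (hMf : Module.Finite R M) (hfid : FinId M) (rs : List R)
    (hrs : ∀ r ∈ rs, r ∈ maximalIdeal R) (hreg : IsWeaklyRegular M rs)
    (hlen : (rs.length : ℕ∞) = (maximalIdeal R).height) (i : ℕ) (hi : (i : ℕ∞) < (maximalIdeal R).height) :
    Subsingleton (Ext (ModuleCat.of R (R ⧸ maximalIdeal R)) (ModuleCat.of R (M →ₗ[R] N)) i) := by
  obtain ⟨⟨x0, hx0⟩, hNf, hfs, hinj0, hker, hG⟩ := hN
  have : Nontrivial N := ⟨x0, 0, hx0⟩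
  have hms : closedPoint R ∈ Module.support R N := IsLocalRing.closedPoint_mem_support R N
  have hle : htM R N (closedPoint R) ≤ (maximalIdeal R).height := htM_le N _ hms
  rw [← hlen] at hle hi
  have hi' : i < rs.length := by exact_mod_cast hi
  obtain ⟨t, ht⟩ := ENat.ne_top_iff_exists.1 (ne_top_of_le_ne_top (ENat.natCast_ne_top _) hle)
  rw [← ht] at hle
  have htd : t ≤ rs.length := by exact_mod_cast hle
  have hpt : ∀ p ∈ Module.support R N, htM R N p ≤ t := fun p hp => by
    rw [ht]; exact htM_mono N p _ hp hms (le_maximalIdeal p.2.ne_top)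
  set F := heightFiltration R N with hF
  have hempty : ∀ p, p ∉ F (t + 1) := fun p hp => by
    have h1 := hp.2.trans (hpt p hp.1)
    have : t + 1 ≤ t := by exact_mod_cast h1
    omega
  have hinj := theta_inj F N hinj0 hker
  have hf : ∀ j, Function.Injective ((cousinTheta R F N j).codRestrict (finSupp R (F j \ F (j + 1)) (cousinK R F N j))
      (fun x => hfs j ⟨x, rfl⟩)) := fun j x y hxy => hinj j (congrArg Subtype.val hxy)
  refine chain_main (fun j => cousinK R F N j) (fun j => ModuleCat.of R (cousinC R F N j))
    (fun j => (cousinTheta R F N j).codRestrict (finSupp R (F j \ F (j + 1)) (cousinK R F N j))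
      (fun x => hfs j ⟨x, rfl⟩)) 
    (fun j => Submodule.mkQ (Submodule.comap (finSupp R (F j \ F (j + 1)) (cousinK R F N j)).subtype
      (LinearMap.range (thetaFull R (F j \ F (j + 1)) (cousinK R F N j))))) hf 
    (fun j => Submodule.mkQ_surjective _) ?_ hNf (fun A hA i j => ginj_ext _ (hG j) A hA i) t rs.length
    htd ?_ ?_ M hMf hfid rs hrs hreg rfl i hi'
  · intro j x
    constructor
    · intro hx
      obtain ⟨y, hy⟩ := (Submodule.Quotient.mk_eq_zero _).1 hx
      exact ⟨y, Subtype.ext hy⟩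
    · rintro ⟨y, rfl⟩
      exact (Submodule.Quotient.mk_eq_zero _).2 ⟨y, rfl⟩
  · refine ⟨fun x y => hinj (t + 1) ?_⟩
    funext p
    exact absurd p.2.1 (hempty p.1)
  · intro j hj _
    apply decomp_finSupp
    intro p hp hle
    apply hp.2
    refine ⟨hp.1.1, ?_⟩
    have : closedPoint R ≤ p := hle
    refine le_trans ?_ (htM_mono N _ _ hms hp.1.1 this)
    rw [← ht]
    exact_mod_cast hj

end GGProof

open GG CategoryTheory in
/-- If `N` is G–Gorenstein and `M` is maximal Cohen–Macaulay of finite injective dimension,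
then `Hom_R(M, N)` is strongly torsion free. -/
theorem stmt15 (R : Type u) [CommRing R] [IsLocalRing R] [IsNoetherianRing R]
    (hCM : IsCMLocalRing R) (hR : HasDualizingComplex R)
    (N : ModuleCat.{u} R) (hN : IsGGorenstein R N)
    (M : ModuleCat.{u} R) (hMf : Module.Finite R M) (hMCM : IsMaximalCM R M)
    (hid : ∃ n, idLE R M n) :
    ∀ F : ModuleCat.{u} R, (∃ n, fdLE R F n) →
      Subsingleton (((Tor (ModuleCat.{u} R) 1).obj F).obj (ModuleCat.of R (M →ₗ[R] N))) := by
  rintro F ⟨n, G, d, ε, hG, hε, h0, hs, hn⟩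
  have hdim := IsLocalRing.maximalIdeal_height_eq_ringKrullDim (R := R)
  obtain ⟨e, he⟩ := ENat.ne_top_iff_exists.1 
    (Ideal.height_ne_top (I := IsLocalRing.maximalIdeal R) (Ideal.IsPrime.ne_top inferInstance))
  have hRd : mdepth R R = e := by
    rw [he]
    have : (mdepth R R : WithBot ℕ∞) = _ := hCM
    rw [← hdim] at this
    exact_mod_cast this
  have hMd : mdepth R M = e := by
    rw [he]
    have : (mdepth R M : WithBot ℕ∞) = _ := hMCM.1
    rw [hMCM.2, ← hdim] at this
    exact_mod_cast this
  obtain ⟨rR, hR1, hR2, hR3⟩ := GGProof.exists_seq R e hRd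
  obtain ⟨rM, hM1, hM2, hM3⟩ := GGProof.exists_seq M e hMd
  obtain ⟨k, I, dI, εI, hI, hεI, hI0, hId, hIn⟩ := hid
  have hfid : GGProof.FinId M := GGProof.fid_of_cores M k I dI εI hI hεI hI0 hId hIn
  have hNf : Module.Finite R N := hN.2.1
  refine GGProof.tor_vanish (M →ₗ[R] N) ?_ F n G d ε hG hε h0 hs hn
  intro q hq
  refine GGProof.hreg_of_ext (M →ₗ[R] N) ?_ ?_ q hq
  · exact fun i hi => GGProof.hom_ext_k N hN M hMf hfid rM hM2 hM3 (by rw [hM1, he]) i hi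
  · intro i hi
    refine GGProof.ext_k_vanish rR R hR2 hR3 i ?_
    rw [← he] at hi
    rw [hR1]
    exact_mod_cast hi
end

section
/- Let M be an R-module and F a filtration of Spec R admitting M, such that the Cousin complex C(F, M) is exact at M, M⁰, M¹, …, M^t. If M has finite injective dimension (respectively finite flat dimension) over R, then each term M^i for i = 0, …, t has finite injective dimension (respectively finite flat dimension) over R. -/
universe u

namespace GGaux

open CategoryTheory GG

variable {R : Type u} [CommRing R]

section General

variable {A B C : Type u} [AddCommGroup A] [Module R A] [AddCommGroup B] [Module R B]
  [AddCommGroup C] [Module R C]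

/-- Mathlib's injective dimension bound for an unbundled module. -/
abbrev ID (R : Type u) [CommRing R] (A : Type u) [AddCommGroup A] [Module R A] (n : ℕ) : Prop :=
  HasInjectiveDimensionLT (ModuleCat.of R A) n

lemma ses (f : A →ₗ[R] B) (g : B →ₗ[R] C) (hf : Function.Injective f)
    (hg : Function.Surjective g) (h : Function.Exact f g) :
    (ShortComplex.mk (ModuleCat.ofHom f) (ModuleCat.ofHom g)
      (by ext x; exact h.apply_apply_eq_zero x)).ShortExact where
  exact := by
    rw [ShortComplex.ShortExact.moduleCat_exact_iff_function_exact]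
    exact h
  mono_f := (ModuleCat.mono_iff_injective _).mpr hf
  epi_g := (ModuleCat.epi_iff_surjective _).mpr hg

lemma id_one : ID R A 1 ↔ Module.Injective R A := by
  rw [Module.injective_iff_injective_object, injective_iff_hasInjectiveDimensionLT_one]

lemma id_X1 (f : A →ₗ[R] B) (g : B →ₗ[R] C) (hf : Function.Injective f)
    (hg : Function.Surjective g) (h : Function.Exact f g) (n : ℕ)
    (hC : ID R C n) (hB : ID R B (n + 1)) : ID R A (n + 1) :=
  (ses f g hf hg h).hasInjectiveDimensionLT_X₁ n hC hB

lemma id_X3 (f : A →ₗ[R] B) (g : B →ₗ[R] C) (hf : Function.Injective f)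
    (hg : Function.Surjective g) (h : Function.Exact f g) (n : ℕ)
    (hB : ID R B n) (hA : ID R A (n + 1)) : ID R C n :=
  (ses f g hf hg h).hasInjectiveDimensionLT_X₃ n hB hA

lemma id_mono {n m : ℕ} (h : n ≤ m) (hA : ID R A n) : ID R A m :=
  hasInjectiveDimensionLT_of_ge _ n m h

lemma id_equiv (e : A ≃ₗ[R] B) {n : ℕ} (hA : ID R A n) : ID R B n :=
  hasInjectiveDimensionLT_of_iso e.toModuleIso n

lemma dual_exact (f : A →ₗ[R] B) (g : B →ₗ[R] C)
    (hg : Function.Surjective g) (h : Function.Exact f g) :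
    Function.Exact (CharacterModule.dual g) (CharacterModule.dual f) := by
  intro c
  constructor
  · intro hc
    have hk : ∀ x y, g x = g y → c x = c y := by
      intro x y hxy
      have : g (x - y) = 0 := by rw [map_sub, hxy, sub_self]
      obtain ⟨a, ha⟩ := (h _).1 this
      have h0 : c (f a) = 0 := DFunLike.congr_fun hc a
      rw [ha, map_sub] at h0
      exact sub_eq_zero.1 h0
    choose s hs using hg
    let c' : C →+ AddCircle (1 : ℚ) :=
      { toFun := fun z => c (s z)
        map_zero' := by
          rw [← map_zero c]
          exact hk _ _ (by simp [hs])
        map_add' := fun x y => by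
          rw [← map_add c]
          exact hk _ _ (by simp [hs]) }
    refine ⟨c', ?_⟩
    apply CharacterModule.ext
    intro x
    exact hk _ _ (hs _)
  · rintro ⟨c, rfl⟩
    apply CharacterModule.ext
    intro x
    change c (g (f x)) = 0
    rw [h.apply_apply_eq_zero, map_zero]

end General

lemma idLE_to_ID (n : ℕ) : ∀ (M : Type u) [AddCommGroup M] [Module R M],
    idLE R M n → ID R M (n + 1) := by
  induction n with
  | zero =>
    rintro M _ _ ⟨G, d, ε, hG, hε, h0, hd, hz⟩
    have hs : Function.Surjective ε := by
      intro x
      have : x ∈ LinearMap.ker (d 0) := hz 1 (by omega) _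
      rwa [← h0] at this
    exact id_equiv (LinearEquiv.ofBijective ε ⟨hε, hs⟩).symm (id_one.2 (hG 0))
  | succ n ih =>
    rintro M _ _ ⟨G, d, ε, hG, hε, h0, hd, hz⟩
    have hN : idLE R (LinearMap.range (d 0)) n := by
      refine ⟨fun i => G (i + 1), fun i => d (i + 1), (LinearMap.range (d 0)).subtype,
        fun i => hG _, Subtype.val_injective, ?_, fun i => hd _, fun i hi => hz _ (by omega)⟩
      rw [Submodule.range_subtype]
      exact hd 0
    refine id_X1 ε (d 0).rangeRestrict hε (d 0).surjective_rangeRestrict ?_ (n + 1) (ih _ hN)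
      (id_mono (by omega) (id_one.2 (hG 0)))
    rw [LinearMap.exact_iff, LinearMap.ker_rangeRestrict, h0]

/-- Splice sequence of objects. -/
def spliceG (X : ModuleCat.{u} R) (G : ℕ → ModuleCat.{u} R) : ℕ → ModuleCat.{u} R
  | 0 => X
  | n + 1 => G n

/-- Splice sequence of differentials (going up). -/
def spliceUp (X : ModuleCat.{u} R) (G : ℕ → ModuleCat.{u} R) (f : X →ₗ[R] G 0)
    (d : ∀ i, G i →ₗ[R] G (i + 1)) : ∀ i, spliceG X G i →ₗ[R] spliceG X G (i + 1)
  | 0 => f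
  | n + 1 => d n

/-- Splice sequence of differentials (going down). -/
def spliceDown (X : ModuleCat.{u} R) (G : ℕ → ModuleCat.{u} R) (f : G 0 →ₗ[R] X)
    (d : ∀ i, G (i + 1) →ₗ[R] G i) : ∀ i, spliceG X G (i + 1) →ₗ[R] spliceG X G i
  | 0 => f
  | n + 1 => d n

lemma splice_zero_all (X : ModuleCat.{u} R) (i : ℕ) (hi : 0 < i)
    (x : spliceG X (fun _ => ModuleCat.of R PUnit.{u+1}) i) : x = 0 := by
  cases i with
  | zero => omega
  | succ i => exact Subsingleton.elim (α := PUnit.{u+1}) x 0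

lemma injective_punit : Module.Injective R PUnit.{u+1} where
  out _ _ _ _ _ _ _ _ _ := ⟨0, fun _ => rfl⟩

lemma ID_to_idLE (n : ℕ) : ∀ (M : Type u) [AddCommGroup M] [Module R M],
    ID R M (n + 1) → idLE R M n := by
  induction n with
  | zero =>
    intro M _ _ h
    refine ⟨spliceG (ModuleCat.of R M) (fun _ => ModuleCat.of R PUnit.{u+1}),
      spliceUp _ _ 0 (fun _ => 0), LinearMap.id, ?_, fun _ _ h => h, ?_, ?_, ?_⟩
    · rintro (_ | i)
      · exact id_one.1 h
      · exact injective_punit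
    · change LinearMap.range LinearMap.id = LinearMap.ker (0 : M →ₗ[R] PUnit.{u+1})
      simp
    · intro i
      ext x
      have := splice_zero_all (ModuleCat.of R M) (i + 1) (by omega) x
      subst this
      simp
    · exact fun i hi x => splice_zero_all _ i hi x
  | succ n ih =>
    intro M _ _ h
    obtain ⟨⟨I, hI, f, hf⟩⟩ := EnoughInjectives.presentation (ModuleCat.of R M)
    have hI' : Module.Injective R I := by
      rw [Module.injective_iff_injective_object]; exact hI
    have hf' : Function.Injective f.hom := (ModuleCat.mono_iff_injective f).1 hf
    have hN : ID R (I ⧸ LinearMap.range f.hom) (n + 1) :=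
      id_X3 f.hom (Submodule.mkQ _) hf' (Submodule.mkQ_surjective _)
        (by rw [LinearMap.exact_iff, Submodule.ker_mkQ]) _
        (id_mono (by omega) (id_one.2 hI')) h
    obtain ⟨G, d, ε, hG, hε, h0, hd, hz⟩ := ih _ hN
    refine ⟨spliceG I G, spliceUp I G (ε ∘ₗ Submodule.mkQ _) d, f.hom, ?_, hf', ?_, ?_, ?_⟩
    · rintro (_ | i)
      · exact hI'
      · exact hG i
    · change LinearMap.range f.hom = LinearMap.ker (ε ∘ₗ Submodule.mkQ _)
      rw [LinearMap.ker_comp, LinearMap.ker_eq_bot.2 hε, Submodule.comap_bot, Submodule.ker_mkQ]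
    · rintro (_ | i)
      · change LinearMap.range (ε ∘ₗ Submodule.mkQ _) = LinearMap.ker (d 0)
        rw [LinearMap.range_comp, Submodule.range_mkQ, Submodule.map_top, h0]
      · exact hd i
    · rintro (_ | i) hi x
      · omega
      · exact hz i (by omega) x

lemma fdLE_to_ID (n : ℕ) : ∀ (M : Type u) [AddCommGroup M] [Module R M],
    fdLE R M n → ID R (CharacterModule M) (n + 1) := by
  induction n with
  | zero =>
    rintro M _ _ ⟨G, d, ε, hG, hε, h0, hd, hz⟩
    have hi : Function.Injective ε := by
      rw [← LinearMap.ker_eq_bot, h0, eq_bot_iff]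
      rintro _ ⟨x, rfl⟩
      rw [hz 1 (by omega) x, map_zero]
      exact Submodule.zero_mem _
    have := hG 0
    exact id_equiv (CharacterModule.congr (LinearEquiv.ofBijective ε ⟨hi, hε⟩))
      (id_one.2 (Module.Flat.iff_characterModule_injective.1 (hG 0)))
  | succ n ih =>
    rintro M _ _ ⟨G, d, ε, hG, hε, h0, hd, hz⟩
    have hN : fdLE R (LinearMap.range (d 0)) n := by
      refine ⟨fun i => G (i + 1), fun i => d (i + 1), (d 0).rangeRestrict,
        fun i => hG _, (d 0).surjective_rangeRestrict, ?_, fun i => hd _,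
        fun i hi => hz _ (by omega)⟩
      rw [LinearMap.ker_rangeRestrict]
      exact hd 0
    have hex : Function.Exact (LinearMap.range (d 0)).subtype ε := by
      rw [LinearMap.exact_iff, Submodule.range_subtype, h0]
    exact id_X1 (CharacterModule.dual ε) (CharacterModule.dual (LinearMap.range (d 0)).subtype)
      (CharacterModule.dual_injective_of_surjective _ hε)
      (CharacterModule.dual_surjective_of_injective _ Subtype.val_injective)
      (dual_exact _ _ hε hex) (n + 1) (ih _ hN)
      (id_mono (by omega) (id_one.2 (Module.Flat.iff_characterModule_injective.1 (hG 0))))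

lemma ID_to_fdLE (n : ℕ) : ∀ (M : Type u) [AddCommGroup M] [Module R M],
    ID R (CharacterModule M) (n + 1) → fdLE R M n := by
  induction n with
  | zero =>
    intro M _ _ h
    refine ⟨spliceG (ModuleCat.of R M) (fun _ => ModuleCat.of R PUnit.{u+1}),
      spliceDown _ _ 0 (fun _ => 0), LinearMap.id, ?_, fun x => ⟨x, rfl⟩, ?_, ?_, ?_⟩
    · rintro (_ | i)
      · exact Module.Flat.iff_characterModule_injective.2 (id_one.1 h)
      · exact (inferInstance : Module.Flat R PUnit.{u+1})
    · change LinearMap.ker LinearMap.id = LinearMap.range (0 : PUnit.{u+1} →ₗ[R] M)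
      simp
    · intro i
      ext x
      have := splice_zero_all (ModuleCat.of R M) (i + 1) (by omega) x
      subst this
      simp
    · exact fun i hi x => splice_zero_all _ i hi x
  | succ n ih =>
    intro M _ _ h
    let f : (M →₀ R) →ₗ[R] M := Finsupp.linearCombination R id
    have hf : Function.Surjective f := Finsupp.linearCombination_id_surjective R M
    have hfl : Module.Flat R (M →₀ R) := inferInstance
    have hex : Function.Exact (LinearMap.ker f).subtype f := by
      rw [LinearMap.exact_iff, Submodule.range_subtype]
    have hN : ID R (CharacterModule (LinearMap.ker f)) (n + 1) :=
      id_X3 (CharacterModule.dual f) (CharacterModule.dual (LinearMap.ker f).subtype)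
        (CharacterModule.dual_injective_of_surjective _ hf)
        (CharacterModule.dual_surjective_of_injective _ Subtype.val_injective)
        (dual_exact _ _ hf hex) _
        (id_mono (by omega) (id_one.2 (Module.Flat.iff_characterModule_injective.1 hfl))) h
    obtain ⟨G, d, ε, hG, hε, h0, hd, hz⟩ := ih _ hN
    refine ⟨spliceG (ModuleCat.of R (M →₀ R)) G,
      spliceDown (ModuleCat.of R (M →₀ R)) G ((LinearMap.ker f).subtype ∘ₗ ε) d,
      f, ?_, hf, ?_, ?_, ?_⟩
    · rintro (_ | i)
      · exact hfl
      · exact hG i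
    · change LinearMap.ker f = LinearMap.range ((LinearMap.ker f).subtype ∘ₗ ε)
      rw [LinearMap.range_comp, LinearMap.range_eq_top.2 hε, Submodule.map_top,
        Submodule.range_subtype]
    · rintro (_ | i)
      · change LinearMap.ker ((LinearMap.ker f).subtype ∘ₗ ε) = LinearMap.range (d 0)
        rw [LinearMap.ker_comp, Submodule.ker_subtype, Submodule.comap_bot, h0]
      · exact hd i
    · rintro (_ | i) hi x
      · omega
      · exact hz i (by omega) x

section FinSupp

variable (S : Set (PrimeSpectrum R))
variable {A B C : Type u} [AddCommGroup A] [Module R A] [AddCommGroup B] [Module R B]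
  [AddCommGroup C] [Module R C]

/-- Localization of a linear map at a prime. -/
noncomputable abbrev lmap (p : S) (f : A →ₗ[R] B) :
    LocalizedModule p.1.asIdeal.primeCompl A →ₗ[R] LocalizedModule p.1.asIdeal.primeCompl B :=
  IsLocalizedModule.map p.1.asIdeal.primeCompl
    (LocalizedModule.mkLinearMap p.1.asIdeal.primeCompl A)
    (LocalizedModule.mkLinearMap p.1.asIdeal.primeCompl B) f

/-- Functoriality of the direct sum of localizations. -/
noncomputable def fmap (f : A →ₗ[R] B) : finSupp R S A →ₗ[R] finSupp R S B where
  toFun x := ⟨fun p => lmap S p f (x.1 p), x.2.subset (fun p hp h => hp (by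
    simp only [h, map_zero]))⟩
  map_add' x y := by
    apply Subtype.ext
    funext p
    exact map_add (lmap S p f) (x.1 p) (y.1 p)
  map_smul' r x := by
    apply Subtype.ext
    funext p
    exact map_smul (lmap S p f) r (x.1 p)

lemma fmap_apply (f : A →ₗ[R] B) (x : finSupp R S A) (p : S) :
    (fmap S f x).1 p = lmap S p f (x.1 p) := rfl

lemma fmap_lift (f : A →ₗ[R] B) (y : finSupp R S B)
    (h : ∀ p, ∃ x, lmap S p f x = y.1 p) : ∃ x, fmap S f x = y := by
  classical
  choose x hx using h
  refine ⟨⟨fun p => if y.1 p = 0 then 0 else x p, y.2.subset ?_⟩, ?_⟩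
  · intro p hp h
    exact hp (by simp [h])
  · apply Subtype.ext
    funext p
    rw [fmap_apply]
    by_cases h : y.1 p = 0
    · simp [h]
    · simp only [h, if_false, hx]

lemma fmap_exact (f : A →ₗ[R] B) (g : B →ₗ[R] C) (h : Function.Exact f g) :
    Function.Exact (fmap S f) (fmap S g) := by
  have hl := fun p : S => LocalizedModule.map_exact p.1.asIdeal.primeCompl f g h
  intro y
  constructor
  · intro hy
    exact fmap_lift S f y fun p => (hl p _).1 (congrFun (congrArg Subtype.val hy) p)
  · rintro ⟨x, rfl⟩
    apply Subtype.ext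
    funext p
    exact (hl p).apply_apply_eq_zero _

lemma fmap_surj (f : A →ₗ[R] B) (h : Function.Surjective f) :
    Function.Surjective (fmap S f) := fun y => fmap_lift S f y fun p =>
  IsLocalizedModule.map_surjective p.1.asIdeal.primeCompl
    (LocalizedModule.mkLinearMap p.1.asIdeal.primeCompl A)
    (LocalizedModule.mkLinearMap p.1.asIdeal.primeCompl B) f h (y.1 p)

lemma fmap_inj (f : A →ₗ[R] B) (h : Function.Injective f) :
    Function.Injective (fmap S f) := fun x y hxy => Subtype.ext <| funext fun p =>
  IsLocalizedModule.map_injective p.1.asIdeal.primeCompl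
    (LocalizedModule.mkLinearMap p.1.asIdeal.primeCompl A)
    (LocalizedModule.mkLinearMap p.1.asIdeal.primeCompl B) f h
    (congrFun (congrArg Subtype.val hxy) p)

lemma finSupp_zero (h : ∀ x : A, x = 0) (x : finSupp R S A) : x = 0 := by
  have : Subsingleton A := ⟨fun a b => by rw [h a, h b]⟩
  apply Subtype.ext
  funext p
  exact Subsingleton.elim _ _

/-- The direct sum of localizations as a `DFinsupp`. -/
noncomputable def finSuppOf :
    (Π₀ p : S, LocalizedModule p.1.asIdeal.primeCompl A) →ₗ[R] finSupp R S A where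
  toFun x := ⟨fun p => x p, x.finite_support⟩
  map_add' x y := rfl
  map_smul' r x := rfl

lemma finSuppOf_bij : Function.Bijective (finSuppOf S (A := A)) := by
  classical
  constructor
  · intro x y h
    ext p
    exact congrFun (congrArg Subtype.val h) p
  · intro y
    refine ⟨DFinsupp.mk (Set.Finite.toFinset y.2) fun p => y.1 p, ?_⟩
    apply Subtype.ext
    funext p
    change (DFinsupp.mk (β := fun p : S => LocalizedModule p.1.asIdeal.primeCompl A)
      (Set.Finite.toFinset y.2) fun p => y.1 p) p = y.1 p
    rw [DFinsupp.mk_apply]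
    split_ifs with h
    · rfl
    · simpa [eq_comm] using h

lemma finSupp_flat [Module.Flat R A] : Module.Flat R (finSupp R S A) := by
  have : ∀ p : S, Module.Flat R (LocalizedModule p.1.asIdeal.primeCompl A) := fun p =>
    Module.Flat.trans R (Localization p.1.asIdeal.primeCompl) _
  exact Module.Flat.of_linearEquiv (LinearEquiv.ofBijective _ (finSuppOf_bij S (A := A))).symm

lemma loc_extend [IsNoetherianRing R] (hA : Module.Injective R A) (T : Submonoid R) (I : Ideal R)
    (g : I →ₗ[R] LocalizedModule T A) :
    ∃ z : LocalizedModule T A, ∀ x : I, x.1 • z = g x := by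
  have : Module.FinitePresentation R I := Module.finitePresentation_of_finite R I
  obtain ⟨h, s, hs⟩ := Module.FinitePresentation.exists_lift_of_isLocalizedModule T
    (LocalizedModule.mkLinearMap T A) g
  obtain ⟨h', hh'⟩ := Module.Baer.of_injective hA I h
  refine ⟨LocalizedModule.mk (h' 1) s, fun x => ?_⟩
  apply IsLocalizedModule.smul_injective (LocalizedModule.mkLinearMap T A) s
  have h1 := LinearMap.congr_fun hs x
  change _ = s • g x at h1
  change s • _ = s • _
  rw [← h1, smul_comm]
  have h2 : s • LocalizedModule.mk (h' 1) s = LocalizedModule.mkLinearMap T A (h' 1) := by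
    rw [LocalizedModule.mkLinearMap_apply, ← LocalizedModule.mk_cancel s (h' 1)]
    exact LocalizedModule.smul'_mk (s : R) (h' 1) s
  rw [h2, ← map_smul, ← map_smul, smul_eq_mul, mul_one, hh' x.1 x.2]
  rfl

lemma finSupp_injective [IsNoetherianRing R] (hA : Module.Injective R A) :
    Module.Injective R (finSupp R S A) := by
  classical
  apply Module.Baer.injective
  intro I g
  have key : ∀ p : S, ∃ z : LocalizedModule p.1.asIdeal.primeCompl A,
      ∀ x : I, x.1 • z = (g x).1 p := fun p =>
    loc_extend hA p.1.asIdeal.primeCompl I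
      ((LinearMap.proj p ∘ₗ (finSupp R S A).subtype) ∘ₗ g)
  choose z hz using key
  obtain ⟨s, hs⟩ := (inferInstance : Module.Finite R I).fg_top
  have hfin : (⋃ x ∈ s, {p : S | (g x).1 p ≠ 0}).Finite :=
    s.finite_toSet.biUnion fun x _ => (g x).2
  have hzero : ∀ p, p ∉ (⋃ x ∈ s, {p : S | (g x).1 p ≠ 0}) → ∀ x, (g x).1 p = 0 := by
    intro p hp x
    have hle : (⊤ : Submodule R I) ≤
        LinearMap.ker ((LinearMap.proj p ∘ₗ (finSupp R S A).subtype) ∘ₗ g) := by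
      rw [← hs, Submodule.span_le]
      intro y hy
      by_contra hne
      exact hp (Set.mem_biUnion hy hne)
    exact hle (Submodule.mem_top (x := x))
  let w : finSupp R S A := ⟨fun p => if p ∈ (⋃ x ∈ s, {p : S | (g x).1 p ≠ 0}) then z p else 0,
    hfin.subset fun p hp => by
      by_contra h
      exact hp (if_neg h)⟩
  refine ⟨LinearMap.toSpanSingleton R _ w, fun x hx => ?_⟩
  apply Subtype.ext
  funext p
  change x • (if p ∈ (⋃ x ∈ s, {p : S | (g x).1 p ≠ 0}) then z p else 0) = _
  split_ifs with h
  · exact hz p ⟨x, hx⟩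
  · rw [smul_zero, hzero p h]

lemma finSupp_idLE [IsNoetherianRing R] {n : ℕ} (h : idLE R A n) : idLE R (finSupp R S A) n := by
  obtain ⟨G, d, ε, hG, hε, h0, hd, hz⟩ := h
  refine ⟨fun i => ModuleCat.of R (finSupp R S (G i)), fun i => fmap S (d i), fmap S ε,
    fun i => finSupp_injective S (hG i), fmap_inj S ε hε, ?_, fun i => ?_,
    fun i hi x => finSupp_zero S (hz i hi) x⟩
  · exact (LinearMap.exact_iff.1 (fmap_exact S _ _ (LinearMap.exact_iff.2 h0.symm))).symm
  · exact (LinearMap.exact_iff.1 (fmap_exact S _ _ (LinearMap.exact_iff.2 (hd i).symm))).symm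

lemma finSupp_fdLE {n : ℕ} (h : fdLE R A n) : fdLE R (finSupp R S A) n := by
  obtain ⟨G, d, ε, hG, hε, h0, hd, hz⟩ := h
  refine ⟨fun i => ModuleCat.of R (finSupp R S (G i)), fun i => fmap S (d i), fmap S ε,
    fun i => ?_, fmap_surj S ε hε, ?_, fun i => ?_,
    fun i hi x => finSupp_zero S (hz i hi) x⟩
  · have := hG i
    exact finSupp_flat S
  · exact LinearMap.exact_iff.1 (fmap_exact S _ _ (LinearMap.exact_iff.2 h0))
  · exact LinearMap.exact_iff.1 (fmap_exact S _ _ (LinearMap.exact_iff.2 (hd i)))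

/-- The canonical map into the direct sum. -/
noncomputable def theta' (h : LinearMap.range (thetaFull R S A) ≤ finSupp R S A) :
    A →ₗ[R] finSupp R S A :=
  (thetaFull R S A).codRestrict _ fun x => h ⟨x, rfl⟩

lemma theta'_inj (h : LinearMap.range (thetaFull R S A) ≤ finSupp R S A)
    (hi : Function.Injective (thetaFull R S A)) : Function.Injective (theta' S h) :=
  fun _ _ hxy => hi (congrArg Subtype.val hxy)

lemma theta'_exact (h : LinearMap.range (thetaFull R S A) ≤ finSupp R S A) :
    Function.Exact (theta' S h) (Submodule.mkQ
      (Submodule.comap (finSupp R S A).subtype (LinearMap.range (thetaFull R S A)))) := by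
  rw [LinearMap.exact_iff, Submodule.ker_mkQ]
  ext y
  constructor
  · rintro ⟨x, hx⟩
    exact ⟨x, Subtype.ext hx⟩
  · rintro ⟨x, rfl⟩
    exact ⟨x, rfl⟩

lemma next_id [IsNoetherianRing R] (h : LinearMap.range (thetaFull R S A) ≤ finSupp R S A)
    (hi : Function.Injective (thetaFull R S A)) {n : ℕ} (hA : idLE R A n) :
    idLE R (nextKType R S A) n :=
  ID_to_idLE n _ (id_X3 (theta' S h) (Submodule.mkQ _) (theta'_inj S h hi)
    (Submodule.mkQ_surjective _) (theta'_exact S h) _ (idLE_to_ID n _ (finSupp_idLE S hA))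
    (id_mono (by omega) (idLE_to_ID n _ hA)))

lemma next_fd (h : LinearMap.range (thetaFull R S A) ≤ finSupp R S A)
    (hi : Function.Injective (thetaFull R S A)) {n : ℕ} (hA : fdLE R A n) :
    fdLE R (nextKType R S A) (n + 1) :=
  ID_to_fdLE (n + 1) _ (id_X1 (CharacterModule.dual (Submodule.mkQ _))
    (CharacterModule.dual (theta' S h))
    (CharacterModule.dual_injective_of_surjective _ (Submodule.mkQ_surjective _))
    (CharacterModule.dual_surjective_of_injective _ (theta'_inj S h hi))
    (dual_exact _ _ (Submodule.mkQ_surjective _) (theta'_exact S h)) _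
    (fdLE_to_ID n _ hA) (id_mono (by omega) (fdLE_to_ID n _ (finSupp_fdLE S hA))))

end FinSupp

lemma theta_inj (M : ModuleCat.{u} R) (F : ℕ → Set (PrimeSpectrum R)) (t : ℕ)
    (hex : CousinPartiallyExact R F M t) (i : ℕ) (hi : i ≤ t + 1) :
    Function.Injective (cousinTheta R F M i) := by
  cases i with
  | zero => exact hex.2.1
  | succ i =>
    rw [injective_iff_map_eq_zero]
    intro y hy
    obtain ⟨x, rfl⟩ := Submodule.mkQ_surjective
      (Submodule.comap (finSupp R (F i \ F (i + 1)) (cousinK R F M i)).subtype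
      (LinearMap.range (thetaFull R (F i \ F (i + 1)) (cousinK R F M i)))) y
    have hx : x ∈ LinearMap.ker (cousinD R F M i) := hy
    rw [hex.2.2 i (by omega)] at hx
    exact (Submodule.Quotient.mk_eq_zero _).2 hx

end GGaux

open GG in
/-- If the Cousin complex `C(F, M)` is exact at `M, M⁰, …, M^t` and `M` has finite injective
(resp. flat) dimension, then so does each term `M^i`, `i = 0, …, t`. -/
theorem stmt17 (R : Type u) [CommRing R] [IsNoetherianRing R]
    (M : ModuleCat.{u} R) (F : ℕ → Set (PrimeSpectrum R)) (hF : IsFiltration R F)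
    (hFM : Admits R F M) (t : ℕ) (hex : CousinPartiallyExact R F M t) :
    ((∃ n, idLE R M n) → ∀ i ≤ t, ∃ n, idLE R (cousinC R F M i) n) ∧
    ((∃ n, fdLE R M n) → ∀ i ≤ t, ∃ n, fdLE R (cousinC R F M i) n) := by
  constructor
  · rintro ⟨n, hn⟩ i hi
    have key : ∀ i ≤ t, idLE R (cousinK R F M i) n := by
      intro i
      induction i with
      | zero => exact fun _ => hn
      | succ i ih =>
        intro hi
        exact GGaux.next_id _ (hex.1 i) (GGaux.theta_inj M F t hex i (by omega)) (ih (by omega))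
    exact ⟨n, GGaux.finSupp_idLE _ (key i hi)⟩
  · rintro ⟨n, hn⟩ i hi
    have key : ∀ i ≤ t, fdLE R (cousinK R F M i) (n + i) := by
      intro i
      induction i with
      | zero => exact fun _ => hn
      | succ i ih =>
        intro hi
        exact GGaux.next_fd _ (hex.1 i) (GGaux.theta_inj M F t hex i (by omega)) (ih (by omega))
    exact ⟨n + i, GGaux.finSupp_fdLE _ (key i hi)⟩
end
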